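/- arXiv:1301.1020 — 5 statements merged into one kernel-verified Lean document; each statement's English description precedes it below -/
import Mathlib

section
/- Let X be a connected topological space and let φ, ψ be two flows on X such that every point of X is non-wandering for both φ and ψ. If every z ∈ X satisfies z ∈ cl(int O⁺(z)) ∩ cl(int O⁻(z)), then O⁺(z) = X and O⁻(z) = X for every z ∈ X. (Theorem 2.5 (ii) of the paper, time-oriented case, for complete flows.) -/
open Set

/-- One step of the switched system: apply flow `φ` (if the boolean is `true`)
or flow `ψ` (if it is `false`) for time `s`. -/
def flowStep {X : Type*} [TopologicalSpace X] (φ ψ : Flow ℝ X) (p : Bool × ℝ) (x : X) : X :=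
  if p.1 then φ p.2 x else ψ p.2 x

/-- The point obtained from `x` by successively applying the steps in the list `L`. -/
def flowChain {X : Type*} [TopologicalSpace X] (φ ψ : Flow ℝ X) :
    List (Bool × ℝ) → X → X
  | [], x => x
  | p :: L, x => flowChain φ ψ L (flowStep φ ψ p x)

/-- Points reachable from `z` by a nonempty sequence of steps whose times all satisfy `P`. -/
def flowReach {X : Type*} [TopologicalSpace X] (φ ψ : Flow ℝ X) (P : ℝ → Prop) (z : X) :
    Set X :=
  {y | ∃ L : List (Bool × ℝ), L ≠ [] ∧ (∀ p ∈ L, P p.2) ∧ y = flowChain φ ψ L z}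

/-- The orbit of `z` under the group generated by the two flows. -/
def flowOrbit {X : Type*} [TopologicalSpace X] (φ ψ : Flow ℝ X) (z : X) : Set X :=
  flowReach φ ψ (fun _ => True) z

/-- The positive reachable set of `z`: all times are positive. -/
def flowReachPos {X : Type*} [TopologicalSpace X] (φ ψ : Flow ℝ X) (z : X) : Set X :=
  flowReach φ ψ (fun t => 0 < t) z

/-- The negative reachable set of `z`: all times are negative. -/
def flowReachNeg {X : Type*} [TopologicalSpace X] (φ ψ : Flow ℝ X) (z : X) : Set X :=
  flowReach φ ψ (fun t => t < 0) z

/-- A point `z` is non-wandering for the flow `φ` if every neighborhood of `z` returns to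
itself at arbitrarily large times. -/
def IsNonWandering {X : Type*} [TopologicalSpace X] (φ : Flow ℝ X) (z : X) : Prop :=
  ∀ U ∈ nhds z, ∀ t > (0 : ℝ), ∃ tt > t, ((fun x => φ tt x) '' U ∩ U).Nonempty

section Reach

variable {X : Type*} [TopologicalSpace X] {φ ψ : Flow ℝ X}

theorem flowChain_append (L M : List (Bool × ℝ)) (x : X) :
    flowChain φ ψ (L ++ M) x = flowChain φ ψ M (flowChain φ ψ L x) := by
  induction L generalizing x with
  | nil => rfl
  | cons p L ih => exact ih _

theorem flowReach_trans {P : ℝ → Prop} {x y z : X} (hxy : y ∈ flowReach φ ψ P x)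
    (hyz : z ∈ flowReach φ ψ P y) : z ∈ flowReach φ ψ P x := by
  obtain ⟨L, hL, hLP, rfl⟩ := hxy
  obtain ⟨M, -, hMP, rfl⟩ := hyz
  refine ⟨L ++ M, by simp [hL], fun p hp => ?_, (flowChain_append L M x).symm⟩
  exact (List.mem_append.1 hp).elim (hLP p) (hMP p)

theorem flowStep_mem_flowReach {P : ℝ → Prop} {p : Bool × ℝ} (hp : P p.2) (x : X) :
    flowStep φ ψ p x ∈ flowReach φ ψ P x :=
  ⟨[p], by simp, by simpa using hp, rfl⟩

theorem flow_neg_apply (θ : Flow ℝ X) (t : ℝ) (x : X) : θ (-t) (θ t x) = x := by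
  rw [← θ.map_add, neg_add_cancel, θ.map_zero_apply]

theorem flowStep_neg_flowStep (p : Bool × ℝ) (x : X) :
    flowStep φ ψ (p.1, -p.2) (flowStep φ ψ p x) = x := by
  by_cases hp : p.1 <;> simp [flowStep, hp, flow_neg_apply]

/-- Reversing a chain exchanges its endpoints and negates its times. -/
theorem mem_flowReach_symm {P Q : ℝ → Prop} (hPQ : ∀ t, P t → Q (-t)) {x y : X}
    (h : y ∈ flowReach φ ψ P x) : x ∈ flowReach φ ψ Q y := by
  obtain ⟨L, hL, hLP, rfl⟩ := h
  induction L generalizing x with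
  | nil => exact absurd rfl hL
  | cons p L ih =>
    have hstep : x ∈ flowReach φ ψ Q (flowStep φ ψ p x) := by
      have := flowStep_mem_flowReach (φ := φ) (ψ := ψ) (P := Q) (p := (p.1, -p.2))
        (hPQ _ (hLP p (by simp))) (flowStep φ ψ p x)
      rwa [flowStep_neg_flowStep] at this
    by_cases hnil : L = []
    · subst hnil
      exact hstep
    · exact flowReach_trans (ih hnil fun q hq => hLP q (by simp [hq])) hstep

theorem mem_flowReachNeg_iff {x y : X} : y ∈ flowReachNeg φ ψ x ↔ x ∈ flowReachPos φ ψ y :=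
  ⟨mem_flowReach_symm fun _ ht => neg_pos.2 ht, mem_flowReach_symm fun _ ht => neg_neg_of_pos ht⟩

/-- A set invariant under every step with time in `P` contains the reachable sets of its points. -/
theorem flowReach_subset {P : ℝ → Prop} {V : Set X}
    (hV : ∀ p : Bool × ℝ, P p.2 → ∀ v ∈ V, flowStep φ ψ p v ∈ V) {x : X} (hx : x ∈ V) :
    flowReach φ ψ P x ⊆ V := by
  rintro _ ⟨L, -, hLP, rfl⟩
  induction L generalizing x with
  | nil => exact hx
  | cons p L ih =>
    exact ih (hV p (hLP p (by simp)) x hx) fun q hq => hLP q (by simp [hq])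

/-- The interior of a positive reachable set is invariant under backward motion along a
non-wandering flow whose forward orbits are positively reachable. -/
theorem flow_neg_mem_interior_flowReachPos {θ : Flow ℝ X} (hθ : ∀ z, IsNonWandering θ z)
    (hθpos : ∀ t > 0, ∀ y, θ t y ∈ flowReachPos φ ψ y)
    (h : ∀ z : X, z ∈ closure (interior (flowReachNeg φ ψ z)))
    {x v : X} (hv : v ∈ interior (flowReachPos φ ψ x)) {s : ℝ} (hs : 0 < s) :
    θ (-s) v ∈ interior (flowReachPos φ ψ x) := by
  have hopen : IsOpen (θ s ⁻¹' interior (flowReachPos φ ψ x)) :=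
    isOpen_interior.preimage (θ.continuous_toFun s)
  have hcancel : ∀ y, θ s (θ (-s) y) = y := fun y => by
    rw [← θ.map_add, add_neg_cancel, θ.map_zero_apply]
  refine interior_maximal ?_ hopen (show θ s (θ (-s) v) ∈ _ by rwa [hcancel])
  intro w hw
  obtain ⟨q, hqV, hqW⟩ := mem_closure_iff.1 (h w) _ hopen hw
  set V' := interior (flowReachPos φ ψ x) ∩ θ (-s) ⁻¹' interior (flowReachNeg φ ψ w)
  have hV'open : IsOpen V' :=
    isOpen_interior.inter (isOpen_interior.preimage (θ.continuous_toFun (-s)))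
  have hqV' : θ s q ∈ V' := ⟨hqV, by simpa only [mem_preimage, flow_neg_apply] using hqW⟩
  obtain ⟨t, hts, _, ⟨p, hp, rfl⟩, hpt⟩ := hθ _ V' (hV'open.mem_nhds hqV') s hs
  have hxp : p ∈ flowReachPos φ ψ x := interior_subset hp.1
  have hpw : θ (-s) (θ t p) ∈ flowReachNeg φ ψ w := interior_subset hpt.2
  rw [← θ.map_add] at hpw
  exact flowReach_trans (flowReach_trans hxp (hθpos (-s + t) (by linarith) p))
    (mem_flowReachNeg_iff.1 hpw)

end Reach

/-- Theorem 2.5 (ii): on a connected space, if every point is non-wandering for both flows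
and lies in the closure of the interior of both its positive and negative reachable sets,
then all reachable sets are the whole space. -/
theorem reach_eq_univ_of_nonWandering
    {X : Type*} [TopologicalSpace X] [ConnectedSpace X] (φ ψ : Flow ℝ X)
    (hφ : ∀ z : X, IsNonWandering φ z) (hψ : ∀ z : X, IsNonWandering ψ z)
    (h : ∀ z : X, z ∈ closure (interior (flowReachPos φ ψ z)) ∩
      closure (interior (flowReachNeg φ ψ z))) :
    ∀ z : X, flowReachPos φ ψ z = univ ∧ flowReachNeg φ ψ z = univ := by
  have hback : ∀ x, ∀ p : Bool × ℝ, p.2 < 0 → ∀ v ∈ interior (flowReachPos φ ψ x),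
      flowStep φ ψ p v ∈ interior (flowReachPos φ ψ x) := by
    rintro x ⟨b, s⟩ hs v hv
    have hs' : 0 < -s := neg_pos.2 hs
    cases b
    · simpa [flowStep] using flow_neg_mem_interior_flowReachPos hψ
        (fun t ht y => flowStep_mem_flowReach (φ := φ) (ψ := ψ) (p := (false, t)) ht y)
        (fun z => (h z).2) hv hs'
    · simpa [flowStep] using flow_neg_mem_interior_flowReachPos hφ
        (fun t ht y => flowStep_mem_flowReach (φ := φ) (ψ := ψ) (p := (true, t)) ht y)
        (fun z => (h z).2) hv hs'
  have hmem : ∀ {x y z}, y ∈ interior (flowReachPos φ ψ x) → y ∈ flowReachPos φ ψ z →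
      z ∈ interior (flowReachPos φ ψ x) := fun hyx hyz =>
    flowReach_subset (hback _) hyx (mem_flowReachNeg_iff.2 hyz)
  have hself : ∀ z, z ∈ interior (flowReachPos φ ψ z) := fun z => by
    obtain ⟨y, hy⟩ := closure_nonempty_iff.1 ⟨z, (h z).1⟩
    exact hmem hy (interior_subset hy)
  have huniv : ∀ z, flowReachPos φ ψ z = univ := fun z => by
    have hclosed : IsClosed (interior (flowReachPos φ ψ z)) := isClosed_of_closure_subset
      fun w hw => by
        obtain ⟨y, hyw, hyz⟩ := mem_closure_iff.1 hw _ isOpen_interior (hself w)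
        exact hmem hyz (interior_subset hyw)
    have hclopen := IsClopen.eq_univ ⟨hclosed, isOpen_interior⟩ ⟨z, hself z⟩
    exact eq_univ_of_univ_subset (hclopen ▸ interior_subset)
  refine fun z => ⟨huniv z, eq_univ_of_forall fun y => mem_flowReachNeg_iff.2 ?_⟩
  rw [huniv y]
  trivial
end

section
/- (Local Rashevski–Chow theorem, time-unoriented case, on ℝⁿ.) Let n ≥ 1, k ≥ 1, and let X₁, X₂ : ℝⁿ → ℝⁿ be vector fields of class C^k admitting global flows φ₁, φ₂. If z ∈ ℝⁿ satisfies Lie^{k−1}(X₁, X₂)(z) = ℝⁿ, then z lies in the interior of its orbit: z ∈ int O(z). (Theorem 2.3 (i) of the paper, stated in ℝⁿ with complete vector fields.) -/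
open Set

/-- Iterated Lie brackets of the two vector fields `X₁, X₂`: level `0` consists of
`X₁` and `X₂` themselves, and level `m+1` consists of brackets `[Xᵢ, V]` with `V` of
level `m`. -/
def iterBrackets {E : Type*} [NormedAddCommGroup E] [NormedSpace ℝ E]
    (X₁ X₂ : E → E) : ℕ → Set (E → E)
  | 0 => {X₁, X₂}
  | m + 1 => {W | ∃ V ∈ iterBrackets X₁ X₂ m,
      W = VectorField.lieBracket ℝ X₁ V ∨ W = VectorField.lieBracket ℝ X₂ V}

/-- The point obtained from `x` by successively applying the (global) flows `φ₁, φ₂`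
with the switching pattern and times recorded in the list `L`. -/
def mapChain {E : Type*} (φ₁ φ₂ : ℝ → E → E) : List (Bool × ℝ) → E → E
  | [], x => x
  | p :: L, x => mapChain φ₁ φ₂ L (if p.1 then φ₁ p.2 x else φ₂ p.2 x)

/-- Points reachable from `z` by a nonempty sequence of steps of the two flows, all of
whose times satisfy the predicate `P`. -/
def mapReach {E : Type*} (φ₁ φ₂ : ℝ → E → E) (P : ℝ → Prop) (z : E) : Set E :=
  {y | ∃ L : List (Bool × ℝ), L ≠ [] ∧ (∀ p ∈ L, P p.2) ∧ y = mapChain φ₁ φ₂ L z}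

section Flow

open Filter Topology
open scoped unitInterval

/-- Pointwise application of a continuous family of continuous linear maps to a continuous
function, as a continuous linear map in the family. -/
noncomputable def ContinuousMap.pointwiseApplyCLM (K E F : Type*) [TopologicalSpace K]
    [CompactSpace K] [NormedAddCommGroup E] [NormedSpace ℝ E] [NormedAddCommGroup F]
    [NormedSpace ℝ F] : C(K, E →L[ℝ] F) →L[ℝ] (C(K, E) →L[ℝ] C(K, F)) :=
  LinearMap.mkContinuous₂
    (LinearMap.mk₂ ℝ
      (fun (A : C(K, E →L[ℝ] F)) (γ : C(K, E)) => (⟨fun t => A t (γ t), by fun_prop⟩ : C(K, F)))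
      (fun _ _ _ => by ext; simp) (fun _ _ _ => by ext; simp)
      (fun _ _ _ => by ext; simp) (fun _ _ _ => by ext; simp))
    1 fun A γ => by
      rw [one_mul]
      refine (ContinuousMap.norm_le _ (by positivity)).2 fun t => ?_
      exact ((A t).le_opNorm _).trans
        (mul_le_mul (A.norm_coe_le_norm t) (γ.norm_coe_le_norm t) (norm_nonneg _)
          ((norm_nonneg _).trans (A.norm_coe_le_norm t)))

theorem ContinuousMap.eventually_forall_norm_sub_le {K E G : Type*} [TopologicalSpace K]
    [CompactSpace K] [NormedAddCommGroup E] [NormedAddCommGroup G] {D : E → G}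
    (hD : Continuous D) (γ : C(K, E)) {c : ℝ} (hc : 0 < c) :
    ∀ᶠ h : C(K, E) in 𝓝 0, ∀ t, ‖D (γ t + h t) - D (γ t)‖ ≤ c := by
  have h1 : Continuous fun h : C(K, E) => (⟨D, hD⟩ : C(E, G)).comp (γ + h) :=
    (ContinuousMap.continuous_postcomp _).comp (continuous_const.add continuous_id)
  filter_upwards [h1.tendsto 0 (Metric.closedBall_mem_nhds _ hc)] with h hh t
  simpa [dist_eq_norm] using (ContinuousMap.dist_apply_le_dist t).trans hh

/-- The superposition operator of a `C¹` map is differentiable on the space of continuous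
functions on a compact space. -/
theorem ContinuousMap.hasFDerivAt_postcomp {K E F : Type*} [TopologicalSpace K]
    [CompactSpace K] [NormedAddCommGroup E] [NormedSpace ℝ E] [NormedAddCommGroup F]
    [NormedSpace ℝ F] {X : E → F} (hX : ContDiff ℝ 1 X) (γ : C(K, E)) :
    HasFDerivAt (fun γ : C(K, E) => (⟨X, hX.continuous⟩ : C(E, F)).comp γ)
      (ContinuousMap.pointwiseApplyCLM K E F
        ((⟨fderiv ℝ X, hX.continuous_fderiv one_ne_zero⟩ : C(E, E →L[ℝ] F)).comp γ)) γ := by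
  rw [hasFDerivAt_iff_isLittleO_nhds_zero, Asymptotics.isLittleO_iff]
  intro c hc
  obtain ⟨δ, hδ, H⟩ := Metric.eventually_nhds_iff.1
    (ContinuousMap.eventually_forall_norm_sub_le (hX.continuous_fderiv one_ne_zero) γ hc)
  refine Metric.eventually_nhds_iff.2 ⟨δ, hδ, fun h hh => ?_⟩
  rw [dist_zero_right] at hh
  refine (ContinuousMap.norm_le _ (by positivity)).2 fun t => ?_
  have key := Convex.norm_image_sub_le_of_norm_fderiv_le' (𝕜 := ℝ) (f := X) (C := c)
    (φ := fderiv ℝ X (γ t)) (s := segment ℝ (γ t) (γ t + h t)) (x := γ t) (y := γ t + h t)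
    (fun x _ => hX.differentiable one_ne_zero x) ?_ (convex_segment _ _)
    (left_mem_segment _ _ _) (right_mem_segment _ _ _)
  · rw [add_sub_cancel_left] at key
    refine key.trans ?_
    gcongr
    exact h.norm_coe_le_norm t
  · intro x hx
    rw [segment_eq_image'] at hx
    obtain ⟨s, hs, rfl⟩ := hx
    have h1 : dist (s • h) 0 < δ := by
      rw [dist_zero_right, norm_smul, Real.norm_of_nonneg hs.1]
      exact (mul_le_of_le_one_left (norm_nonneg _) hs.2).trans_lt hh
    simpa using H h1 t

/-- The superposition operator of a `C^k` map is `C^k` on the space of continuous functions on a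
compact space. -/
theorem ContinuousMap.contDiff_postcomp {K : Type*} [TopologicalSpace K] [CompactSpace K] (k : ℕ)
    {E F : Type} [NormedAddCommGroup E] [NormedSpace ℝ E] [NormedAddCommGroup F]
    [NormedSpace ℝ F] {X : E → F} (hX : ContDiff ℝ k X) :
    ContDiff ℝ k (fun γ : C(K, E) => (⟨X, hX.continuous⟩ : C(E, F)).comp γ) := by
  induction k generalizing F with
  | zero =>
    exact contDiff_zero.2 (ContinuousMap.continuous_postcomp _)
  | succ k ih =>
    have h1 : ContDiff ℝ 1 X := hX.of_le (by norm_cast; omega)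
    have h2 : ContDiff ℝ k (fderiv ℝ X) := hX.fderiv_right (by norm_cast)
    refine contDiff_succ_iff_hasFDerivAt.2 ⟨_, ?_, fun γ => ContinuousMap.hasFDerivAt_postcomp h1 γ⟩
    exact (ContinuousMap.pointwiseApplyCLM K E F).contDiff.comp (ih h2)

/-- Uniqueness on `[0, 1]` for integral curves of a `C¹` vector field. -/
theorem ContDiff.integralCurve_unique_unitInterval {E : Type*} [NormedAddCommGroup E]
    [NormedSpace ℝ E] {Y : E → E} (hY : ContDiff ℝ 1 Y) {f g : ℝ → E}
    (hf : ∀ t ∈ Icc (0 : ℝ) 1, HasDerivAt f (Y (f t)) t)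
    (hg : ∀ t ∈ Icc (0 : ℝ) 1, HasDerivAt g (Y (g t)) t) (h0 : f 0 = g 0) : f 1 = g 1 := by
  have hfc : ContinuousOn f (Icc 0 1) := fun t ht => (hf t ht).continuousAt.continuousWithinAt
  have hgc : ContinuousOn g (Icc 0 1) := fun t ht => (hg t ht).continuousAt.continuousWithinAt
  obtain ⟨C, hC⟩ := (hY.locallyLipschitz.locallyLipschitzOn
    (s := f '' Icc 0 1 ∪ g '' Icc 0 1)).exists_lipschitzOnWith_of_compact
    ((isCompact_Icc.image_of_continuousOn hfc).union (isCompact_Icc.image_of_continuousOn hgc))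
  exact ODE_solution_unique_of_mem_Icc_right (v := fun _ => Y)
    (s := fun _ => f '' Icc 0 1 ∪ g '' Icc 0 1) (fun _ _ => hC) hfc
    (fun t ht => (hf t (Ico_subset_Icc_self ht)).hasDerivWithinAt)
    (fun t ht => Or.inl (mem_image_of_mem _ (Ico_subset_Icc_self ht))) hgc
    (fun t ht => (hg t (Ico_subset_Icc_self ht)).hasDerivWithinAt)
    (fun t ht => Or.inr (mem_image_of_mem _ (Ico_subset_Icc_self ht))) h0
    (right_mem_Icc.2 zero_le_one)

variable {E : Type} [NormedAddCommGroup E] [NormedSpace ℝ E]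

theorem flow_neg_flow {X : E → E} (hX : ContDiff ℝ 1 X) {φ : ℝ → E → E} (h0 : ∀ x, φ 0 x = x)
    (hφ : ∀ (t : ℝ) (x : E), HasDerivAt (fun s => φ s x) (X (φ t x)) t) (t : ℝ) (x : E) :
    φ (-t) (φ t x) = x := by
  have hY : ContDiff ℝ 1 (fun y => (-t) • X y) := hX.const_smul _
  have := hY.integralCurve_unique_unitInterval (f := fun s => φ ((-t) * s) (φ t x))
    (g := fun s => φ (t + (-t) * s) x) (fun s _ => ?_) (fun s _ => ?_) (by simp [h0])
  · simpa [h0] using this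
  · exact (hφ _ _).scomp s (hasDerivAt_const_mul (-t))
  · exact (hφ _ _).scomp s (by simpa using (hasDerivAt_const_mul (x := s) (-t)).const_add t)

/-- The primitive vanishing at `0`, as a continuous linear operator on `C([0, 1], E)`. -/
noncomputable def unitInterval.primitiveCLM (E : Type*) [NormedAddCommGroup E] [NormedSpace ℝ E] :
    C(I, E) →L[ℝ] C(I, E) :=
  LinearMap.mkContinuous
    { toFun := fun γ => ⟨fun t => ∫ s in (0 : ℝ)..t, γ (projIcc 0 1 zero_le_one s), by
        have hc : Continuous fun s : ℝ => γ (projIcc 0 1 zero_le_one s) :=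
          γ.continuous.comp continuous_projIcc
        exact (intervalIntegral.continuous_primitive
          (fun a b => hc.intervalIntegrable a b) 0).comp continuous_subtype_val⟩
      map_add' := fun γ η => by
        have hc (γ : C(I, E)) : Continuous fun s : ℝ => γ (projIcc 0 1 zero_le_one s) :=
          γ.continuous.comp continuous_projIcc
        ext t
        exact intervalIntegral.integral_add ((hc γ).intervalIntegrable _ _)
          ((hc η).intervalIntegrable _ _)
      map_smul' := fun c γ => by
        ext t
        exact intervalIntegral.integral_smul _ _ }
    1 fun γ => by
      rw [one_mul]
      refine (ContinuousMap.norm_le _ (norm_nonneg _)).2 fun t => ?_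
      refine (intervalIntegral.norm_integral_le_of_norm_le_const
        (fun s _ => γ.norm_coe_le_norm _)).trans ?_
      rw [sub_zero, abs_of_nonneg t.2.1]
      exact mul_le_of_le_one_right (norm_nonneg _) t.2.2

theorem unitInterval.primitiveCLM_apply (γ : C(I, E)) (t : I) :
    unitInterval.primitiveCLM E γ t = ∫ s in (0 : ℝ)..t, γ (projIcc 0 1 zero_le_one s) := rfl

/-- A global flow of a `C^k` vector field, `k ≥ 1`, is jointly `C^k` near time `0`. -/
theorem contDiffAt_flow_zero [CompleteSpace E] {k : ℕ} (hk : 1 ≤ k) {X : E → E}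
    (hX : ContDiff ℝ k X) {φ : ℝ → E → E} (h0 : ∀ x, φ 0 x = x)
    (hφ : ∀ (t : ℝ) (x : E), HasDerivAt (fun s => φ s x) (X (φ t x)) t) (x₀ : E) :
    ContDiffAt ℝ k (fun p : ℝ × E => φ p.1 p.2) (0, x₀) := by
  have hX1 : ContDiff ℝ 1 X := hX.of_le (by exact_mod_cast hk)
  have hk0 : (k : WithTop ℕ∞) ≠ 0 := by norm_cast; omega
  let N : C(I, E) → C(I, E) := fun γ => (⟨X, hX.continuous⟩ : C(E, E)).comp γ
  have hN : ContDiff ℝ k N := ContinuousMap.contDiff_postcomp k hX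
  let cst : E →L[ℝ] C(I, E) := ContinuousLinearMap.const ℝ I
  let J := unitInterval.primitiveCLM E
  let Φ : (ℝ × E) × C(I, E) → C(I, E) := fun p => p.2 - cst p.1.2 - p.1.1 • J (N p.2)
  have hΦ : ContDiff ℝ k Φ := by
    have : ContDiff ℝ k fun p : (ℝ × E) × C(I, E) => J (N p.2) :=
      J.contDiff.comp (hN.comp contDiff_snd)
    have h2 : ContDiff ℝ k fun p : (ℝ × E) × C(I, E) => cst p.1.2 :=
      cst.contDiff.comp (contDiff_snd.comp contDiff_fst)
    exact (contDiff_snd.sub h2).sub ((contDiff_fst.comp contDiff_fst).smul this)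
  let u : (ℝ × E) × C(I, E) := ((0, x₀), cst x₀)
  have hu : Φ u = 0 := by simp [Φ, u]
  have hinv : (fderiv ℝ Φ u ∘L .inr ℝ (ℝ × E) C(I, E)) = ContinuousLinearMap.id ℝ C(I, E) := by
    have h1 : HasFDerivAt Φ (fderiv ℝ Φ u) u := (hΦ.differentiable hk0 u).hasFDerivAt
    have h2 : HasFDerivAt (fun γ : C(I, E) => (((0 : ℝ), x₀), γ))
      (.inr ℝ (ℝ × E) C(I, E)) (cst x₀) := hasFDerivAt_prodMk_right _ _
    have h3 := h1.comp (cst x₀) h2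
    have h4 : (Φ ∘ fun γ : C(I, E) => (((0 : ℝ), x₀), γ)) = fun γ => γ - cst x₀ := by
      ext γ
      simp [Φ]
    rw [h4] at h3
    exact h3.unique ((hasFDerivAt_id _).sub_const _)
  have hinv' : (fderiv ℝ Φ u ∘L .inr ℝ (ℝ × E) C(I, E)).IsInvertible := by
    rw [hinv]; exact ⟨.refl _ _, rfl⟩
  have hev := hΦ.contDiffAt.eventually_apply_implicitFunction hk0 hinv'
  have hcd := hΦ.contDiffAt.contDiffAt_implicitFunction hk0 hinv'
  set g := hΦ.contDiffAt.implicitFunction hk0 hinv'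
  have hcd1 : ContDiffAt ℝ k (fun p => g p 1) (0, x₀) :=
    (ContinuousMap.evalCLM (M := E) ℝ (1 : I)).contDiff.contDiffAt.comp (0, x₀) hcd
  refine hcd1.congr_of_eventuallyEq ?_
  filter_upwards [hev] with p hp
  obtain ⟨ε, x⟩ := p
  rw [hu] at hp
  set γ := g (ε, x)
  have hγ (t : I) : γ t = x + ε • ∫ s in (0 : ℝ)..t, X (γ (projIcc 0 1 zero_le_one s)) := by
    have := congrArg (fun η : C(I, E) => η t) hp
    simp only [Φ, J, N, cst, ContinuousMap.sub_apply, ContinuousMap.smul_apply,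
      unitInterval.primitiveCLM_apply, ContinuousMap.zero_apply, ContinuousMap.comp_apply,
      sub_eq_zero] at this
    rw [← sub_eq_iff_eq_add']
    exact this
  let f : ℝ → E := fun t => x + ε • ∫ s in (0 : ℝ)..t, X (γ (projIcc 0 1 zero_le_one s))
  have hf : ∀ t ∈ Icc (0 : ℝ) 1, HasDerivAt f (ε • X (f t)) t := by
    intro t ht
    have hc : Continuous fun s : ℝ => X (γ (projIcc 0 1 zero_le_one s)) :=
      hX.continuous.comp (γ.continuous.comp continuous_projIcc)
    have hft : f t = γ (projIcc 0 1 zero_le_one t) := by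
      rw [hγ, projIcc_of_mem _ ht]
    rw [hft]
    exact ((hc.integral_hasStrictDerivAt 0 t).hasDerivAt.const_smul ε).const_add x
  have := (hX1.const_smul ε).integralCurve_unique_unitInterval (f := fun s => φ (ε * s) x)
    (g := f) (fun s _ => ?_) hf (by simp [f, h0])
  · simp only [mul_one] at this
    change φ ε x = γ 1
    rw [this, hγ]
    rfl
  · exact (hφ _ _).scomp s (by simpa using (hasDerivAt_id s).const_mul ε)

end Flow

section Accessibility

open Filter Topology

variable {E : Type} [NormedAddCommGroup E] [NormedSpace ℝ E]

/-- If a vector field is tangent to the image of an immersion of class `C²`, it lifts locally to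
a differentiable vector field. -/
theorem exists_differentiableAt_lift {P : Type*} [NormedAddCommGroup P] [NormedSpace ℝ P]
    [FiniteDimensional ℝ P] [FiniteDimensional ℝ E] {F : P → E} {t : P} (hF : ContDiffAt ℝ 2 F t)
    (hinj : Function.Injective (fderiv ℝ F t)) {V : E → E} (hV : DifferentiableAt ℝ V (F t))
    (hVF : ∀ᶠ s in 𝓝 t, V (F s) ∈ (fderiv ℝ F s).range) :
    ∃ v : P → P, DifferentiableAt ℝ v t ∧ ∀ᶠ s in 𝓝 t, fderiv ℝ F s (v s) = V (F s) := by
  obtain ⟨L₀, hL₀⟩ := (fderiv ℝ F t).toLinearMap.exists_leftInverse_of_injective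
    (LinearMap.ker_eq_bot.2 hinj)
  let L : E →L[ℝ] P := L₀.toContinuousLinearMap
  have hdF : DifferentiableAt ℝ (fderiv ℝ F) t :=
    (hF.fderiv_right (m := 1) (by norm_num)).differentiableAt one_ne_zero
  have hA : DifferentiableAt ℝ (fun s => L ∘L fderiv ℝ F s) t :=
    (differentiableAt_const L).clm_comp hdF
  have hAt : L ∘L fderiv ℝ F t = ContinuousLinearMap.id ℝ P := by
    ext x
    exact LinearMap.congr_fun hL₀ x
  have hinv : (L ∘L fderiv ℝ F t).IsInvertible := by
    rw [hAt]; exact ⟨.refl _ _, rfl⟩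
  have : CompleteSpace P := FiniteDimensional.complete ℝ P
  have hev : ∀ᶠ s in 𝓝 t, (L ∘L fderiv ℝ F s).IsInvertible :=
    hA.continuousAt.eventually (ContinuousLinearEquiv.nhds hinv.choose |> fun h => by
      rw [hinv.choose_spec] at h; exact h)
  refine ⟨fun s => (L ∘L fderiv ℝ F s).inverse (L (V (F s))), ?_, ?_⟩
  · refine DifferentiableAt.clm_apply ?_ (L.differentiableAt.comp t
      (hV.comp t (hF.differentiableAt two_ne_zero)))
    exact ((hinv.contDiffAt_map_inverse (n := 1)).differentiableAt one_ne_zero).comp t hA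
  · filter_upwards [hev, hVF] with s hs ⟨w, hw⟩
    have hinvw : (L ∘L fderiv ℝ F s).inverse (L (V (F s))) = w := by
      rw [← hw]; exact hs.inverse_apply_eq.2 rfl
    rw [hinvw]
    exact hw

/-- The Lie bracket of two vector fields tangent to an immersed submanifold is tangent to it. -/
theorem lieBracket_mem_range_fderiv {P : Type*} [NormedAddCommGroup P] [NormedSpace ℝ P]
    [FiniteDimensional ℝ P] [FiniteDimensional ℝ E] {F : P → E} {t : P} (hF : ContDiffAt ℝ 2 F t)
    (hinj : Function.Injective (fderiv ℝ F t)) {V W : E → E} (hV : DifferentiableAt ℝ V (F t))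
    (hW : DifferentiableAt ℝ W (F t))
    (hVF : ∀ᶠ s in 𝓝 t, V (F s) ∈ (fderiv ℝ F s).range)
    (hWF : ∀ᶠ s in 𝓝 t, W (F s) ∈ (fderiv ℝ F s).range) :
    VectorField.lieBracket ℝ V W (F t) ∈ (fderiv ℝ F t).range := by
  obtain ⟨v, hv, hv'⟩ := exists_differentiableAt_lift hF hinj hV hVF
  obtain ⟨w, hw, hw'⟩ := exists_differentiableAt_lift hF hinj hW hWF
  refine ⟨VectorField.lieBracket ℝ v w t, ?_⟩
  have hFt := hF.differentiableAt two_ne_zero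
  have h1 : fderiv ℝ (fun s => fderiv ℝ F s (w s)) t = fderiv ℝ W (F t) ∘L fderiv ℝ F t := by
    rw [EventuallyEq.fderiv_eq hw']
    exact fderiv_comp t hW hFt
  have h2 : fderiv ℝ (fun s => fderiv ℝ F s (v s)) t = fderiv ℝ V (F t) ∘L fderiv ℝ F t := by
    rw [EventuallyEq.fderiv_eq hv']
    exact fderiv_comp t hV hFt
  refine (VectorField.fderiv_apply_lieBracket hF (by simp) hw hv).trans ?_
  rw [h1, h2]
  simp only [ContinuousLinearMap.comp_apply, hv'.self_of_nhds, hw'.self_of_nhds]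
  rfl

theorem eventually_injective_fderiv {P : Type*} [NormedAddCommGroup P] [NormedSpace ℝ P]
    [FiniteDimensional ℝ P] {F : P → E} {t : P} (hF : ContDiffAt ℝ 1 F t)
    (hinj : Function.Injective (fderiv ℝ F t)) :
    ∀ᶠ s in 𝓝 t, Function.Injective (fderiv ℝ F s) :=
  (hF.fderiv_right (m := 0) le_rfl).continuousAt.eventually
    (ContinuousLinearMap.isOpen_injective.mem_nhds hinj)

theorem iterBrackets_contDiff_and_tangent {P : Type*} [NormedAddCommGroup P] [NormedSpace ℝ P]
    [FiniteDimensional ℝ P] [FiniteDimensional ℝ E] {k : ℕ} {X₁ X₂ : E → E}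
    (hX₁ : ContDiff ℝ k X₁) (hX₂ : ContDiff ℝ k X₂) (m : ℕ) (hm : m < k) {V : E → E}
    (hV : V ∈ iterBrackets X₁ X₂ m) :
    ContDiff ℝ (k - m : ℕ) V ∧ ∀ {F : P → E} {t₀ : P}, ContDiffAt ℝ k F t₀ →
      Function.Injective (fderiv ℝ F t₀) →
      (∀ᶠ t in 𝓝 t₀, X₁ (F t) ∈ (fderiv ℝ F t).range) →
      (∀ᶠ t in 𝓝 t₀, X₂ (F t) ∈ (fderiv ℝ F t).range) →
      ∀ᶠ t in 𝓝 t₀, V (F t) ∈ (fderiv ℝ F t).range := by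
  induction m generalizing V with
  | zero =>
    rcases hV with rfl | rfl
    · exact ⟨hX₁, fun _ _ h _ => h⟩
    · exact ⟨hX₂, fun _ _ _ h => h⟩
  | succ m ih =>
    obtain ⟨W, hW, hVW⟩ := hV
    obtain ⟨hWd, hWt⟩ := ih (by omega) hW
    have hle : ((k - (m + 1) : ℕ) : WithTop ℕ∞) + 1 ≤ (k - m : ℕ) := by norm_cast; omega
    have hkm : ((k - m : ℕ) : WithTop ℕ∞) ≤ k := by norm_cast; omega
    have h2k : (2 : WithTop ℕ∞) ≤ k := by norm_cast; omega
    have hk0 : (k : WithTop ℕ∞) ≠ 0 := by norm_cast; omega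
    have hm0 : ((k - m : ℕ) : WithTop ℕ∞) ≠ 0 := by norm_cast; omega
    have main {X : E → E} (hX : ContDiff ℝ k X) {F : P → E} {t₀ : P} (hF : ContDiffAt ℝ k F t₀)
        (hinj : Function.Injective (fderiv ℝ F t₀))
        (hXt : ∀ᶠ t in 𝓝 t₀, X (F t) ∈ (fderiv ℝ F t).range)
        (hWt : ∀ᶠ t in 𝓝 t₀, W (F t) ∈ (fderiv ℝ F t).range) :
        ∀ᶠ t in 𝓝 t₀, VectorField.lieBracket ℝ X W (F t) ∈ (fderiv ℝ F t).range := by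
      have hF2 := hF.of_le h2k
      filter_upwards [hF2.eventually (by simp),
        eventually_injective_fderiv (hF2.of_le one_le_two) hinj,
        hXt.eventually_nhds, hWt.eventually_nhds] with t h1 h2 h3 h4
      exact lieBracket_mem_range_fderiv h1 h2 (hX.differentiable hk0 _)
        (hWd.differentiable hm0 _) h3 h4
    rcases hVW with rfl | rfl
    · exact ⟨(hX₁.of_le hkm).lieBracket_vectorField hWd hle, fun hF hi h1 h2 =>
        main hX₁ hF hi h1 (hWt hF hi h1 h2)⟩
    · exact ⟨(hX₂.of_le hkm).lieBracket_vectorField hWd hle, fun hF hi h1 h2 =>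
        main hX₂ hF hi h2 (hWt hF hi h1 h2)⟩

/-- The bracket generating condition is open. -/
theorem eventually_span_iterBrackets_eq_top [FiniteDimensional ℝ E] {k : ℕ} {X₁ X₂ : E → E}
    (hX₁ : ContDiff ℝ k X₁) (hX₂ : ContDiff ℝ k X₂) {z : E}
    (hz : Submodule.span ℝ {v : E | ∃ m < k, ∃ V ∈ iterBrackets X₁ X₂ m, v = V z} = ⊤) :
    ∀ᶠ x in 𝓝 z,
      Submodule.span ℝ {v : E | ∃ m < k, ∃ V ∈ iterBrackets X₁ X₂ m, v = V x} = ⊤ := by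
  let ι := {V : E → E // ∃ m < k, V ∈ iterBrackets X₁ X₂ m}
  have hset (x : E) : {v : E | ∃ m < k, ∃ V ∈ iterBrackets X₁ X₂ m, v = V x} =
      range fun V : ι => V.1 x := by
    ext v
    constructor
    · rintro ⟨m, hm, V, hV, rfl⟩
      exact ⟨⟨V, m, hm, hV⟩, rfl⟩
    · rintro ⟨⟨V, m, hm, hV⟩, rfl⟩
      exact ⟨m, hm, V, hV, rfl⟩
  rw [hset] at hz
  obtain ⟨κ, a, -, hspan, hli⟩ := exists_linearIndependent' ℝ fun V : ι => V.1 z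
  have : Finite κ := hli.finite
  have := Fintype.ofFinite κ
  have hcard : Fintype.card κ = Module.finrank ℝ E := by
    rw [← finrank_span_eq_card hli, hspan, hz, finrank_top]
  have hcont : Continuous fun (x : E) (j : κ) => (a j).1 x := by
    refine continuous_pi fun j => ?_
    obtain ⟨V, m, hm, hV⟩ := a j
    exact (iterBrackets_contDiff_and_tangent (P := ℝ) hX₁ hX₂ m hm hV).1.continuous
  filter_upwards [hcont.continuousAt.eventually hli.eventually] with x hx
  rw [hset, eq_top_iff, ← hx.span_eq_top_of_card_eq_finrank' hcard]
  exact Submodule.span_mono (range_comp_subset_range a fun V : ι => V.1 x)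

/-- Composing an immersion with a flow transverse to its image yields an immersion. -/
theorem injective_fderiv_flow_comp {P : Type*} [NormedAddCommGroup P] [NormedSpace ℝ P]
    {φ : ℝ → E → E} {X : E → E} (h0 : ∀ x, φ 0 x = x)
    (hφ : ∀ (t : ℝ) (x : E), HasDerivAt (fun s => φ s x) (X (φ t x)) t)
    {F : P → E} {t : P} (hF : DifferentiableAt ℝ F t)
    (hd : DifferentiableAt ℝ (fun p : ℝ × E => φ p.1 p.2) (0, F t))
    (hinj : Function.Injective (fderiv ℝ F t)) (hX : X (F t) ∉ (fderiv ℝ F t).range) :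
    Function.Injective (fderiv ℝ (fun p : P × ℝ => φ p.2 (F p.1)) (t, 0)) := by
  set Φ := fderiv ℝ (fun p : ℝ × E => φ p.1 p.2) (0, F t)
  have hΦ : HasFDerivAt (fun p : ℝ × E => φ p.1 p.2) Φ (0, F t) := hd.hasFDerivAt
  have hΦ1 : Φ (1, 0) = X (F t) := by
    have h1 : HasDerivAt (fun s : ℝ => (s, F t)) ((1 : ℝ), (0 : E)) 0 :=
      (hasDerivAt_id (0 : ℝ)).prodMk (hasDerivAt_const _ _)
    have h2 := hΦ.comp_hasDerivAt (0 : ℝ) h1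
    have h3 := hφ 0 (F t)
    rw [h0] at h3
    exact h2.unique h3
  have hΦ2 (w : E) : Φ (0, w) = w := by
    have h1 := hΦ.comp (F t) (hasFDerivAt_prodMk_right (𝕜 := ℝ) (0 : ℝ) (F t))
    have h2 : ((fun p : ℝ × E => φ p.1 p.2) ∘ fun x : E => ((0 : ℝ), x)) = id := by
      ext x; simp [h0]
    rw [h2] at h1
    exact DFunLike.congr_fun (h1.unique (hasFDerivAt_id _)) w
  have hG : HasFDerivAt (fun p : P × ℝ => φ p.2 (F p.1))
      (Φ ∘L ((ContinuousLinearMap.snd ℝ P ℝ).prod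
        (fderiv ℝ F t ∘L ContinuousLinearMap.fst ℝ P ℝ))) (t, 0) :=
    HasFDerivAt.comp (t, (0 : ℝ)) (f := fun p : P × ℝ => (p.2, F p.1)) hΦ
      (hasFDerivAt_snd.prodMk (hF.hasFDerivAt.comp (t, (0 : ℝ)) hasFDerivAt_fst))
  rw [hG.fderiv, injective_iff_map_eq_zero]
  rintro ⟨v, c⟩ hvc
  have hsum : c • X (F t) + fderiv ℝ F t v = 0 := by
    have : ((c, fderiv ℝ F t v) : ℝ × E) = c • (1, 0) + (0, fderiv ℝ F t v) := by simp
    rw [← hΦ1, ← hΦ2 (fderiv ℝ F t v), ← map_smul, ← map_add, ← this]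
    exact hvc
  have hc : c = 0 := by
    by_contra hc
    refine hX ⟨-(c⁻¹ • v), ?_⟩
    change fderiv ℝ F t (-(c⁻¹ • v)) = X (F t)
    rw [map_neg, map_smul, eq_neg_of_add_eq_zero_right hsum]
    simp [smul_smul, hc]
  subst hc
  rw [zero_smul, zero_add] at hsum
  rw [(injective_iff_map_eq_zero _).1 hinj v hsum]
  rfl

/-- Krener's accessibility theorem: a set which is stable under the small-time flows of `X₁, X₂`
and contains a point where these fields are bracket generating has nonempty interior. -/
theorem nonempty_interior_of_lie_span [FiniteDimensional ℝ E] {k : ℕ} (hk : 1 ≤ k)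
    {X₁ X₂ : E → E} (hX₁ : ContDiff ℝ k X₁) (hX₂ : ContDiff ℝ k X₂) {φ₁ φ₂ : ℝ → E → E}
    (hφ₁0 : ∀ x, φ₁ 0 x = x) (hφ₂0 : ∀ x, φ₂ 0 x = x)
    (hφ₁ : ∀ (t : ℝ) (x : E), HasDerivAt (fun s => φ₁ s x) (X₁ (φ₁ t x)) t)
    (hφ₂ : ∀ (t : ℝ) (x : E), HasDerivAt (fun s => φ₂ s x) (X₂ (φ₂ t x)) t)
    {S : Set E} (hS₁ : ∀ x, ∀ᶠ p : ℝ × E in 𝓝 (0, x), p.2 ∈ S → φ₁ p.1 p.2 ∈ S)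
    (hS₂ : ∀ x, ∀ᶠ p : ℝ × E in 𝓝 (0, x), p.2 ∈ S → φ₂ p.1 p.2 ∈ S) {z : E} (hzS : z ∈ S)
    (hz : Submodule.span ℝ {v : E | ∃ m < k, ∃ V ∈ iterBrackets X₁ X₂ m, v = V z} = ⊤) :
    (interior S).Nonempty := by
  have hk0 : (k : WithTop ℕ∞) ≠ 0 := by norm_cast; omega
  have hk1 : (1 : WithTop ℕ∞) ≤ k := by exact_mod_cast hk
  have : CompleteSpace E := FiniteDimensional.complete ℝ E
  obtain ⟨U, hU, hUo, hzU⟩ := eventually_nhds_iff.1 (eventually_span_iterBrackets_eq_top hX₁ hX₂ hz)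
  let ranks : Set ℕ := {r | ∃ (P : Type) (_ : NormedAddCommGroup P) (_ : NormedSpace ℝ P)
    (_ : FiniteDimensional ℝ P) (F : P → E) (t₀ : P), Module.finrank ℝ P = r ∧
      ContDiffAt ℝ k F t₀ ∧ Function.Injective (fderiv ℝ F t₀) ∧ F t₀ ∈ U ∧
      ∀ᶠ t in 𝓝 t₀, F t ∈ S}
  have hne : ranks.Nonempty := ⟨0, Fin 0 → ℝ, inferInstance, inferInstance, inferInstance,
    fun _ => z, 0, by simp, contDiffAt_const, Function.injective_of_subsingleton _, hzU,
    Eventually.of_forall fun _ => hzS⟩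
  have hbdd : BddAbove ranks := by
    refine ⟨Module.finrank ℝ E, ?_⟩
    rintro r ⟨P, _, _, _, F, t₀, rfl, -, hinj, -⟩
    exact LinearMap.finrank_le_finrank_of_injective (f := (fderiv ℝ F t₀).toLinearMap) hinj
  obtain ⟨P, _, _, _, F, t₀, hr, hF, hinj, hFU, hFS⟩ := Nat.sSup_mem hne hbdd
  have tangent {X : E → E} {φ : ℝ → E → E} (hX : ContDiff ℝ k X) (hφ0 : ∀ x, φ 0 x = x)
      (hφ : ∀ (t : ℝ) (x : E), HasDerivAt (fun s => φ s x) (X (φ t x)) t)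
      (hS : ∀ x, ∀ᶠ p : ℝ × E in 𝓝 (0, x), p.2 ∈ S → φ p.1 p.2 ∈ S) :
      ∀ᶠ t in 𝓝 t₀, X (F t) ∈ (fderiv ℝ F t).range := by
    filter_upwards [hF.eventually (by simp), eventually_injective_fderiv (hF.of_le hk1) hinj,
      hF.continuousAt.eventually (hUo.mem_nhds hFU), hFS.eventually_nhds] with t h1 h2 h3 h4
    by_contra hXt
    have hd := contDiffAt_flow_zero hk hX hφ0 hφ (F t)
    have hprod : ContDiffAt ℝ k (fun p : P × ℝ => (p.2, F p.1)) (t, 0) :=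
      contDiffAt_snd.prodMk (h1.comp (t, (0 : ℝ)) contDiffAt_fst)
    have hmem : Module.finrank ℝ (P × ℝ) ∈ ranks := by
      refine ⟨P × ℝ, inferInstance, inferInstance, inferInstance,
        fun p => φ p.2 (F p.1), (t, 0), rfl,
        ContDiffAt.comp (t, (0 : ℝ)) (g := fun p : ℝ × E => φ p.1 p.2) hd hprod,
        injective_fderiv_flow_comp hφ0 hφ (h1.differentiableAt hk0) (hd.differentiableAt hk0) h2
          hXt, show φ 0 (F t) ∈ U by rw [hφ0]; exact h3, ?_⟩
      filter_upwards [hprod.continuousAt.eventually (hS (F t)),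
        (continuous_fst.tendsto (t, (0 : ℝ))).eventually h4] with p hp1 hp2 using hp1 hp2
    have := le_csSup hbdd hmem
    rw [Module.finrank_prod, Module.finrank_self] at this
    omega
  have hrange : (fderiv ℝ F t₀).range = ⊤ := by
    rw [eq_top_iff, ← hU _ hFU, Submodule.span_le]
    rintro _ ⟨m, hm, V, hV, rfl⟩
    exact ((iterBrackets_contDiff_and_tangent hX₁ hX₂ m hm hV).2 hF hinj
      (tangent hX₁ hφ₁0 hφ₁ hS₁) (tangent hX₂ hφ₂0 hφ₂ hS₂)).self_of_nhds
  have : CompleteSpace P := FiniteDimensional.complete ℝ P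
  refine ⟨F t₀, mem_interior_iff_mem_nhds.2 ?_⟩
  rw [← (hF.hasStrictFDerivAt hk0).map_nhds_eq_of_surj hrange]
  exact hFS

end Accessibility

theorem mapChain_append {α : Type*} (φ₁ φ₂ : ℝ → α → α) (L M : List (Bool × ℝ)) (x : α) :
    mapChain φ₁ φ₂ (L ++ M) x = mapChain φ₁ φ₂ M (mapChain φ₁ φ₂ L x) := by
  induction L generalizing x with
  | nil => rfl
  | cons p L ih => exact ih _

theorem exists_mapChain_leftInverse {α : Type*} {φ₁ φ₂ : ℝ → α → α}
    (h₁ : ∀ t x, φ₁ (-t) (φ₁ t x) = x) (h₂ : ∀ t x, φ₂ (-t) (φ₂ t x) = x) (L : List (Bool × ℝ)) :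
    ∃ M, ∀ x, mapChain φ₁ φ₂ M (mapChain φ₁ φ₂ L x) = x := by
  induction L with
  | nil => exact ⟨[], fun _ => rfl⟩
  | cons p L ih =>
    obtain ⟨M, hM⟩ := ih
    refine ⟨M ++ [(p.1, -p.2)], fun x => ?_⟩
    have h : mapChain φ₁ φ₂ M (mapChain φ₁ φ₂ (p :: L) x) = if p.1 then φ₁ p.2 x else φ₂ p.2 x :=
      hM _
    rw [mapChain_append, h]
    rcases p with ⟨_ | _, t⟩
    · exact h₂ t x
    · exact h₁ t x

/-- Local Rashevski–Chow theorem (time-unoriented case) on ℝⁿ: if the iterated Lie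
brackets of order ≤ k−1 of `X₁, X₂` span ℝⁿ at `z`, then `z` lies in the interior of
its orbit under the two flows. -/
theorem mem_interior_orbit_of_lie_span
    (n k : ℕ) (hn : 1 ≤ n) (hk : 1 ≤ k)
    (X₁ X₂ : EuclideanSpace ℝ (Fin n) → EuclideanSpace ℝ (Fin n))
    (hX₁ : ContDiff ℝ k X₁) (hX₂ : ContDiff ℝ k X₂)
    (φ₁ φ₂ : ℝ → EuclideanSpace ℝ (Fin n) → EuclideanSpace ℝ (Fin n))
    (hφ₁0 : ∀ x, φ₁ 0 x = x) (hφ₂0 : ∀ x, φ₂ 0 x = x)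
    (hφ₁ : ∀ (t : ℝ) (x : EuclideanSpace ℝ (Fin n)),
      HasDerivAt (fun s => φ₁ s x) (X₁ (φ₁ t x)) t)
    (hφ₂ : ∀ (t : ℝ) (x : EuclideanSpace ℝ (Fin n)),
      HasDerivAt (fun s => φ₂ s x) (X₂ (φ₂ t x)) t)
    (z : EuclideanSpace ℝ (Fin n))
    (hLie : Submodule.span ℝ
      {v : EuclideanSpace ℝ (Fin n) |
        ∃ m < k, ∃ V ∈ iterBrackets X₁ X₂ m, v = V z} = ⊤) :
    z ∈ interior (mapReach φ₁ φ₂ (fun _ => True) z) := by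
  open Filter Topology in
  have hk1 : (1 : WithTop ℕ∞) ≤ k := by exact_mod_cast hk
  let S : Set (EuclideanSpace ℝ (Fin n)) :=
    {y | ∃ L, y = mapChain φ₁ φ₂ L z ∧ ContinuousAt (mapChain φ₁ φ₂ L) z}
  have hS {X : EuclideanSpace ℝ (Fin n) → EuclideanSpace ℝ (Fin n)}
      {φ : ℝ → EuclideanSpace ℝ (Fin n) → EuclideanSpace ℝ (Fin n)} (b : Bool)
      (hb : ∀ t x, mapChain φ₁ φ₂ [(b, t)] x = φ t x) (hX : ContDiff ℝ k X)
      (hφ0 : ∀ x, φ 0 x = x) (hφ : ∀ t x, HasDerivAt (fun s => φ s x) (X (φ t x)) t)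
      (x : EuclideanSpace ℝ (Fin n)) :
      ∀ᶠ p : ℝ × EuclideanSpace ℝ (Fin n) in 𝓝 (0, x), p.2 ∈ S → φ p.1 p.2 ∈ S := by
    filter_upwards [((contDiffAt_flow_zero hk hX hφ0 hφ x).of_le hk1).eventually (by simp)]
    rintro ⟨t, y⟩ hc ⟨L, rfl, hL⟩
    refine ⟨L ++ [(b, t)], by rw [mapChain_append, hb], ?_⟩
    have h1 : mapChain φ₁ φ₂ (L ++ [(b, t)]) = φ t ∘ mapChain φ₁ φ₂ L := by
      ext1 x; rw [mapChain_append, hb]; rfl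
    rw [h1]
    refine ContinuousAt.comp ?_ hL
    exact ContinuousAt.comp (f := fun y => (t, y)) (g := fun p : ℝ × _ => φ p.1 p.2)
      hc.continuousAt (by fun_prop)
  obtain ⟨y, hy⟩ := nonempty_interior_of_lie_span hk hX₁ hX₂ hφ₁0 hφ₂0 hφ₁ hφ₂
    (hS true (fun _ _ => rfl) hX₁ hφ₁0 hφ₁) (hS false (fun _ _ => rfl) hX₂ hφ₂0 hφ₂)
    (z := z) ⟨[], rfl, continuousAt_id⟩ hLie
  obtain ⟨L, rfl, hL⟩ := interior_subset hy
  obtain ⟨M, hM⟩ := exists_mapChain_leftInverse (flow_neg_flow (hX₁.of_le hk1) hφ₁0 hφ₁)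
    (flow_neg_flow (hX₂.of_le hk1) hφ₂0 hφ₂) L
  refine mem_interior_iff_mem_nhds.2 ?_
  filter_upwards [hL.eventually (mem_interior_iff_mem_nhds.1 hy)] with x ⟨L', hL', _⟩
  refine ⟨(true, 0) :: (L' ++ M), by simp, fun _ _ => trivial, ?_⟩
  simp only [mapChain, if_true, hφ₁0, mapChain_append]
  rw [← hL', hM]
end

section
/- (Hamiltonian flow-box theorem on ℝ^{2d}.) Let k ≥ 2 be an integer and let H : E → ℝ be of class C^k. Let z₀ ∈ E be such that the differential DH(z₀) is nonzero. Then there exist open sets U, V ⊆ E with z₀ ∈ U and a map ψ : E → E such that: ψ restricted to U is a bijection from U onto V; ψ is C^{k−1} on U and the inverse map is C^{k−1} on V; for every u ∈ U the differential Dψ(u) is a symplectic linear isomorphism of E, i.e. ω₀(Dψ(u)v, Dψ(u)w) = ω₀(v, w) for all v, w ∈ E; and H(u) equals the p₁-coordinate of ψ(u) for every u ∈ U. (Theorem 2.8 of the paper, stated for the standard symplectic vector space (ℝ^{2d}, ω₀).) -/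
open Set

/-- The standard symplectic form `ω₀` on `E = ℝᵈ × ℝᵈ`:
`ω₀((ξ,η),(ξ',η')) = Σᵢ (ξᵢ η'ᵢ − ηᵢ ξ'ᵢ)`. -/
def stdSymplectic (d : ℕ) (v w : (Fin d → ℝ) × (Fin d → ℝ)) : ℝ :=
  ∑ i : Fin d, (v.1 i * w.2 i - v.2 i * w.1 i)

open Filter Topology

universe u

section PostComposition

variable {K : Type*} [TopologicalSpace K] [CompactSpace K]

/-- Pointwise application `C(K, E →L[ℝ] F) → C(K, E) → C(K, F)` as a continuous bilinear map. -/
noncomputable def pointwiseApply (K : Type*) [TopologicalSpace K] [CompactSpace K]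
    (E F : Type*) [NormedAddCommGroup E] [NormedSpace ℝ E]
    [NormedAddCommGroup F] [NormedSpace ℝ F] :
    C(K, E →L[ℝ] F) →L[ℝ] C(K, E) →L[ℝ] C(K, F) :=
  LinearMap.mkContinuous₂
    (LinearMap.mk₂ ℝ
      (fun (A : C(K, E →L[ℝ] F)) (γ : C(K, E)) =>
        (⟨fun s => A s (γ s), by fun_prop⟩ : C(K, F)))
      (fun A B γ => by ext s; simp) (fun c A γ => by ext s; simp)
      (fun A γ η => by ext s; simp) (fun c A γ => by ext s; simp))
    1 (fun A γ => by
      refine (ContinuousMap.norm_le _ (by positivity)).2 fun s => ?_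
      simpa using (A s).le_of_opNorm_le_of_le (A.norm_coe_le_norm s) (γ.norm_coe_le_norm s))

@[simp]
theorem pointwiseApply_apply {E F : Type*} [NormedAddCommGroup E] [NormedSpace ℝ E]
    [NormedAddCommGroup F] [NormedSpace ℝ F] (A : C(K, E →L[ℝ] F)) (γ : C(K, E)) (s : K) :
    pointwiseApply K E F A γ s = A s (γ s) := rfl

/-- Composition with a `C¹` map is Fréchet differentiable on the space of continuous maps on a
compact space. -/
theorem hasFDerivAt_postcomp {E F : Type*} [NormedAddCommGroup E] [NormedSpace ℝ E]
    [NormedAddCommGroup F] [NormedSpace ℝ F] {f : E → F} (hf : Differentiable ℝ f)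
    (hf' : Continuous (fderiv ℝ f)) (γ : C(K, E)) :
    HasFDerivAt (fun η : C(K, E) => (⟨f, hf.continuous⟩ : C(E, F)).comp η)
      (pointwiseApply K E F ((⟨fderiv ℝ f, hf'⟩ : C(E, E →L[ℝ] F)).comp γ)) γ := by
  rw [hasFDerivAt_iff_isLittleO_nhds_zero, Asymptotics.isLittleO_iff]
  intro ε hε
  have hcont := (ContinuousMap.continuous_postcomp (X := K)
    (⟨fderiv ℝ f, hf'⟩ : C(E, E →L[ℝ] F))).continuousAt (x := γ)
  obtain ⟨δ, hδ, hclose⟩ := (Metric.continuousAt_iff (α := C(K, E))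
    (β := C(K, E →L[ℝ] F))).1 hcont ε hε
  filter_upwards [Metric.ball_mem_nhds (0 : C(K, E)) hδ] with η hη
  rw [mem_ball_zero_iff] at hη
  refine (ContinuousMap.norm_le _ (by positivity)).2 fun s => ?_
  have bound : ∀ y ∈ segment ℝ (γ s) (γ s + η s),
      ‖fderiv ℝ f y - fderiv ℝ f (γ s)‖ ≤ ε := by
    intro y hy
    rw [segment_eq_image'] at hy
    obtain ⟨τ, hτ, rfl⟩ := hy
    have hdist : dist (γ + τ • η) γ < δ := by
      rw [dist_eq_norm, add_sub_cancel_left, norm_smul, Real.norm_of_nonneg hτ.1]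
      exact (mul_le_of_le_one_left (norm_nonneg _) hτ.2).trans_lt hη
    have := (ContinuousMap.dist_apply_le_dist s).trans (hclose hdist).le
    simpa [dist_eq_norm] using this
  have key := (convex_segment (𝕜 := ℝ) (γ s) (γ s + η s)).norm_image_sub_le_of_norm_fderiv_le'
    (fun x _ => hf x) bound (left_mem_segment ℝ _ _) (right_mem_segment ℝ _ _)
  rw [add_sub_cancel_left] at key
  refine (le_of_eq_of_le ?_ key).trans ?_
  · simp
  · gcongr
    exact η.norm_coe_le_norm s

/-- Composition with a `Cⁿ` map is `Cⁿ` on the space of continuous maps on a compact space. -/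
theorem contDiff_postcomp {E F : Type u} [NormedAddCommGroup E] [NormedSpace ℝ E]
    [NormedAddCommGroup F] [NormedSpace ℝ F] (n : ℕ) {f : E → F}
    (hf : ContDiff ℝ n f) :
    ContDiff ℝ n (fun η : C(K, E) => (⟨f, hf.continuous⟩ : C(E, F)).comp η) := by
  induction n generalizing F with
  | zero => exact contDiff_zero.2 (ContinuousMap.continuous_postcomp (X := K) ⟨f, hf.continuous⟩)
  | succ n ih =>
    have hf1 : ContDiff ℝ (n + 1) f := by exact_mod_cast hf
    obtain ⟨hd, -, hf'⟩ := contDiff_succ_iff_fderiv.1 hf1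
    have hc := hf.continuous
    change ContDiff ℝ _ (fun η : C(K, E) => (⟨f, hc⟩ : C(E, F)).comp η)
    rw [Nat.cast_succ, contDiff_succ_iff_hasFDerivAt]
    exact ⟨_, (pointwiseApply K E F).contDiff.comp (ih hf'),
      hasFDerivAt_postcomp hd hf'.continuous⟩

end PostComposition

section LocalFlow

open unitInterval

variable {E : Type u} [NormedAddCommGroup E] [NormedSpace ℝ E]

/-- The embedding of `E` into `C(I, E)` by constant paths. -/
noncomputable def constPath (E : Type u) [NormedAddCommGroup E] [NormedSpace ℝ E] :
    E →L[ℝ] C(I, E) :=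
  LinearMap.mkContinuous
    { toFun := fun y => ContinuousMap.const I y
      map_add' := fun _ _ => rfl
      map_smul' := fun _ _ => rfl } 1 (fun y => by
        refine (ContinuousMap.norm_le _ (by positivity)).2 fun s => ?_
        exact (one_mul ‖y‖).ge)

@[simp]
theorem constPath_apply (y : E) (s : I) : constPath E y s = y := rfl

theorem continuous_primitive_unitInterval (γ : C(I, E)) :
    Continuous fun s : ℝ => ∫ τ in (0 : ℝ)..s, IccExtend zero_le_one γ τ :=
  intervalIntegral.continuous_primitive
    (fun a b => (γ.continuous.Icc_extend' (h := zero_le_one)).intervalIntegrable a b) 0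

/-- The operator sending a path on `[0, 1]` to its primitive vanishing at `0`. -/
noncomputable def primitivePath (E : Type u) [NormedAddCommGroup E] [NormedSpace ℝ E] :
    C(I, E) →L[ℝ] C(I, E) :=
  LinearMap.mkContinuous
    { toFun := fun γ =>
        ⟨fun s => ∫ τ in (0 : ℝ)..s, IccExtend zero_le_one γ τ,
          (continuous_primitive_unitInterval γ).comp continuous_subtype_val⟩
      map_add' := fun γ η => by
        ext s
        exact intervalIntegral.integral_add
          ((γ.continuous.Icc_extend' (h := zero_le_one)).intervalIntegrable _ _)
          ((η.continuous.Icc_extend' (h := zero_le_one)).intervalIntegrable _ _)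
      map_smul' := fun c γ => by
        ext s
        exact intervalIntegral.integral_smul c _ } 1 (fun γ => by
        refine (ContinuousMap.norm_le _ (by positivity)).2 fun s => ?_
        have h := intervalIntegral.norm_integral_le_of_norm_le_const (a := (0 : ℝ)) (b := s)
          (f := IccExtend zero_le_one γ) (C := ‖γ‖)
          (fun τ _ => γ.norm_coe_le_norm (projIcc 0 1 zero_le_one τ))
        refine h.trans ?_
        rw [sub_zero, abs_of_nonneg s.2.1, one_mul]
        exact mul_le_of_le_one_right (norm_nonneg _) s.2.2)

/-- A path given by an integral equation extends to a differentiable curve. -/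
theorem exists_hasDerivAt_of_eq_primitivePath [CompleteSpace E] {γ β : C(I, E)} {c : E}
    (h : γ = constPath E c + primitivePath E β) :
    ∃ g : ℝ → E, g 0 = c ∧ (∀ s : I, g s = γ s) ∧ ∀ s : I, HasDerivAt g (β s) s := by
  refine ⟨fun s => c + ∫ τ in (0 : ℝ)..s, IccExtend zero_le_one β τ, by simp, fun s => ?_,
    fun s => ?_⟩
  · rw [h]
    rfl
  · have hd := ((β.continuous.Icc_extend' (h := zero_le_one)).integral_hasStrictDerivAt 0
      (s : ℝ)).hasDerivAt.const_add c
    rwa [IccExtend_val] at hd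

/-- Local flow of a `Cⁿ` vector field `X`, for `n ≥ 1`: it is jointly `Cⁿ` in time and initial
position, its orbits (with time rescaled to `[0, 1]`) are integral curves of `X`, and its
derivatives solve the linearized equation. -/
theorem exists_contDiffAt_flow [CompleteSpace E] {X : E → E} {n : ℕ} (hn : n ≠ 0)
    (hX : ContDiff ℝ n X) (z₀ : E) :
    ∃ Φ : ℝ × E → E, ContDiffAt ℝ n Φ (0, z₀) ∧ Φ (0, z₀) = z₀ ∧
      ∀ᶠ u in 𝓝 ((0 : ℝ), z₀), ∃ γ : ℝ → E, γ 0 = u.2 ∧ γ 1 = Φ u ∧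
        (∀ s ∈ Icc (0 : ℝ) 1, HasDerivAt γ (u.1 • X (γ s)) s) ∧
        ∀ v : ℝ × E, ∃ ζ : ℝ → E, ζ 0 = v.2 ∧ ζ 1 = fderiv ℝ Φ u v ∧
          ∀ s ∈ Icc (0 : ℝ) 1,
            HasDerivAt ζ (v.1 • X (γ s) + u.1 • fderiv ℝ X (γ s) (ζ s)) s := by
  have hn' : ((n : ℕ) : WithTop ℕ∞) ≠ 0 := by exact_mod_cast hn
  have hXc := hX.continuous
  have hXd := hX.differentiable hn'
  have hXd' := hX.continuous_fderiv hn'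
  let N : C(I, E) → C(I, E) := fun η => (⟨X, hXc⟩ : C(E, E)).comp η
  let N' : C(I, E) → C(I, E) →L[ℝ] C(I, E) := fun γ =>
    pointwiseApply I E E ((⟨fderiv ℝ X, hXd'⟩ : C(E, E →L[ℝ] E)).comp γ)
  have hN : ContDiff ℝ n N := contDiff_postcomp n hX
  have hN' : ∀ γ, HasFDerivAt N (N' γ) γ := hasFDerivAt_postcomp hXd hXd'
  let f : (ℝ × E) × C(I, E) → C(I, E) := fun q =>
    q.2 - constPath E q.1.2 - q.1.1 • primitivePath E (N q.2)
  have hf : ContDiff ℝ n f := by fun_prop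
  have hf' : ∀ q w, fderiv ℝ f q w = w.2 - constPath E w.1.2 -
      (q.1.1 • primitivePath E (N' q.2 w.2) + w.1.1 • primitivePath E (N q.2)) := by
    intro q w
    have h1 : HasFDerivAt (fun q : (ℝ × E) × C(I, E) => primitivePath E (N q.2)) _ q :=
      (primitivePath E).hasFDerivAt.comp q ((hN' q.2).comp q hasFDerivAt_snd)
    have h2 : HasFDerivAt (fun q : (ℝ × E) × C(I, E) => constPath E q.1.2) _ q :=
      (constPath E).hasFDerivAt.comp q (hasFDerivAt_fst (𝕜 := ℝ) (p := q)).snd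
    have h3 : HasFDerivAt (fun q : (ℝ × E) × C(I, E) => q.1.1) _ q :=
      (hasFDerivAt_fst (𝕜 := ℝ) (p := q)).fst
    have h4 : HasFDerivAt f _ q := (hasFDerivAt_snd.sub h2).sub (h3.smul h1)
    rw [h4.fderiv]
    simp
  set q₀ : (ℝ × E) × C(I, E) := ((0, z₀), constPath E z₀)
  have hfq₀ : f q₀ = 0 := by simp [f, q₀]
  have hinv : (fderiv ℝ f q₀ ∘L .inr ℝ (ℝ × E) C(I, E)).IsInvertible := by
    have : fderiv ℝ f q₀ ∘L .inr ℝ (ℝ × E) C(I, E) = .id ℝ _ := by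
      ext1 η
      simp [hf', q₀]
    rw [this]
    exact ContinuousLinearMap.isInvertible_equiv (f := .refl ℝ _)
  have cdf : ContDiffAt ℝ n f q₀ := hf.contDiffAt
  set g := cdf.implicitFunction hn' hinv
  have hgn : ContDiffAt ℝ n g (0, z₀) := cdf.contDiffAt_implicitFunction hn' hinv
  have hg0 : g (0, z₀) = constPath E z₀ := cdf.implicitFunction_apply_self hn' hinv
  have hfg : ∀ᶠ u in 𝓝 ((0 : ℝ), z₀), f (u, g u) = 0 := by
    simpa only [hfq₀] using cdf.eventually_apply_implicitFunction hn' hinv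
  let ev : C(I, E) →L[ℝ] E := ContinuousMap.evalCLM ℝ 1
  refine ⟨fun u => ev (g u), ev.contDiff.contDiffAt.comp _ hgn, ?_, ?_⟩
  · change g (0, z₀) 1 = z₀
    rw [hg0, constPath_apply]
  have hgd : ∀ᶠ u in 𝓝 ((0 : ℝ), z₀), DifferentiableAt ℝ g u :=
    (hgn.eventually (by simp)).mono fun u hu => hu.differentiableAt hn'
  filter_upwards [hfg, hfg.eventually_nhds, hgd] with u hu hu' hgu
  obtain ⟨γ, hγ0, hγg, hγ'⟩ := exists_hasDerivAt_of_eq_primitivePath (γ := g u)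
    (β := u.1 • N (g u)) (c := u.2) (by
      rw [map_smul, ← sub_eq_iff_eq_add', ← sub_eq_zero]
      exact hu)
  refine ⟨γ, hγ0, hγg 1, fun s hs => ?_, fun v => ?_⟩
  · have := hγ' ⟨s, hs⟩
    rw [hγg ⟨s, hs⟩]
    exact this
  · have hfu : fderiv ℝ f (u, g u) (v, fderiv ℝ g u v) = 0 := by
      have h1 : HasFDerivAt (fun w => f (w, g w)) _ u :=
        ((hf.differentiable hn') (u, g u)).hasFDerivAt.comp u
          ((hasFDerivAt_id u).prodMk hgu.hasFDerivAt)
      have h2 : HasFDerivAt (fun w => f (w, g w)) (0 : ℝ × E →L[ℝ] C(I, E)) u :=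
        (hasFDerivAt_const (0 : C(I, E)) u).congr_of_eventuallyEq hu'
      simpa using congrArg (fun L => L v) (h1.unique h2)
    rw [hf'] at hfu
    obtain ⟨ζ, hζ0, hζg, hζ'⟩ := exists_hasDerivAt_of_eq_primitivePath (γ := fderiv ℝ g u v)
      (β := v.1 • N (g u) + u.1 • N' (g u) (fderiv ℝ g u v)) (c := v.2) (by
        rw [map_add, map_smul, map_smul, add_comm (v.1 • _), ← sub_eq_iff_eq_add', ← sub_eq_zero]
        exact hfu)
    refine ⟨ζ, hζ0, ?_, fun s hs => ?_⟩
    · have h1 : HasFDerivAt (fun u => ev (g u)) _ u := ev.hasFDerivAt.comp u hgu.hasFDerivAt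
      rw [h1.fderiv]
      exact hζg 1
    · have := hζ' ⟨s, hs⟩
      rw [hγg ⟨s, hs⟩, hζg ⟨s, hs⟩]
      exact this

end LocalFlow

section Hamiltonian

/-- The phase space `ℝᵈ × ℝᵈ`. -/
abbrev PhaseSpace (d : ℕ) : Type := (Fin d → ℝ) × (Fin d → ℝ)

/-- The standard symplectic form as a continuous bilinear map. -/
noncomputable def symplecticForm (d : ℕ) : PhaseSpace d →L[ℝ] PhaseSpace d →L[ℝ] ℝ :=
  LinearMap.toContinuousBilinearMap <| LinearMap.mk₂ ℝ (stdSymplectic d)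
    (fun u v w => by
      simp only [stdSymplectic, ← Finset.sum_add_distrib]
      exact Finset.sum_congr rfl fun i _ => by simp; ring)
    (fun c v w => by
      simp only [stdSymplectic, smul_eq_mul, Finset.mul_sum]
      exact Finset.sum_congr rfl fun i _ => by simp; ring)
    (fun u v w => by
      simp only [stdSymplectic, ← Finset.sum_add_distrib]
      exact Finset.sum_congr rfl fun i _ => by simp; ring)
    (fun c v w => by
      simp only [stdSymplectic, smul_eq_mul, Finset.mul_sum]
      exact Finset.sum_congr rfl fun i _ => by simp; ring)

theorem symplecticForm_apply {d : ℕ} (v w : PhaseSpace d) :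
    symplecticForm d v w = stdSymplectic d v w := rfl

theorem symplecticForm_neg_swap {d : ℕ} (v w : PhaseSpace d) :
    symplecticForm d v w = -symplecticForm d w v := by
  simp only [symplecticForm_apply, stdSymplectic, ← Finset.sum_neg_distrib]
  exact Finset.sum_congr rfl fun i _ => by ring

theorem symplecticForm_self {d : ℕ} (v : PhaseSpace d) : symplecticForm d v v = 0 := by
  have := symplecticForm_neg_swap v v
  linarith

/-- The vector representing a covector through the standard symplectic form. -/
noncomputable def symplecticDual (d : ℕ) : (PhaseSpace d →L[ℝ] ℝ) →L[ℝ] PhaseSpace d :=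
  (ContinuousLinearMap.pi fun i =>
      ContinuousLinearMap.apply ℝ ℝ ((0, Pi.single i 1) : PhaseSpace d)).prod
    (ContinuousLinearMap.pi fun i =>
      -ContinuousLinearMap.apply ℝ ℝ ((Pi.single i 1, 0) : PhaseSpace d))

theorem symplecticForm_symplecticDual {d : ℕ} (l : PhaseSpace d →L[ℝ] ℝ) (w : PhaseSpace d) :
    symplecticForm d (symplecticDual d l) w = l w := by
  have hw : w = ∑ i, (w.2 i • ((0, Pi.single i 1) : PhaseSpace d)
      + w.1 i • ((Pi.single i 1, 0) : PhaseSpace d)) := by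
    ext i <;> simp [Prod.fst_sum, Prod.snd_sum, Finset.sum_apply, Pi.single_apply]
  conv_rhs => rw [hw]
  simp only [map_sum, map_add, map_smul, symplecticForm_apply, stdSymplectic, smul_eq_mul]
  refine Finset.sum_congr rfl fun i _ => ?_
  simp [symplecticDual]
  ring

theorem eq_of_hasDerivAt_zero_unitInterval {F : Type*} [NormedAddCommGroup F] [NormedSpace ℝ F]
    {f : ℝ → F} (hf : ∀ s ∈ Icc (0 : ℝ) 1, HasDerivAt f 0 s) :
    ∀ s ∈ Icc (0 : ℝ) 1, f s = f 0 :=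
  constant_of_has_deriv_right_zero (fun s hs => (hf s hs).continuousAt.continuousWithinAt)
    fun s hs => (hf s (Ico_subset_Icc_self hs)).hasDerivWithinAt

/-- Local Hamiltonian flow of a `C^(n+1)` function `H`: it is jointly `Cⁿ` in time and initial
position, conserves `H`, and pulls `ω₀` back to `ω₀ + dt ∧ dH`. -/
theorem exists_hamiltonian_flow {d n : ℕ} (hn : n ≠ 0) {H : PhaseSpace d → ℝ}
    (hH : ContDiff ℝ (n + 1) H) (z₀ : PhaseSpace d) :
    ∃ Φ : ℝ × PhaseSpace d → PhaseSpace d, ContDiffAt ℝ n Φ (0, z₀) ∧ Φ (0, z₀) = z₀ ∧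
      ∀ᶠ u in 𝓝 ((0 : ℝ), z₀), H (Φ u) = H u.2 ∧
        ∀ v w : ℝ × PhaseSpace d,
          symplecticForm d (fderiv ℝ Φ u v) (fderiv ℝ Φ u w) = symplecticForm d v.2 w.2 +
            (v.1 * fderiv ℝ H u.2 w.2 - w.1 * fderiv ℝ H u.2 v.2) := by
  have hn' : ((n : ℕ) : WithTop ℕ∞) ≠ 0 := by exact_mod_cast hn
  have hHd : Differentiable ℝ H := hH.differentiable (by simp)
  have hH' : ContDiff ℝ n (fderiv ℝ H) := hH.fderiv_right le_rfl
  have hHd' : Differentiable ℝ (fderiv ℝ H) := hH'.differentiable hn'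
  let X : PhaseSpace d → PhaseSpace d := fun z => symplecticDual d (fderiv ℝ H z)
  have hX : ContDiff ℝ n X := (symplecticDual d).contDiff.comp hH'
  have hXω : ∀ z w, symplecticForm d (X z) w = fderiv ℝ H z w := fun z w =>
    symplecticForm_symplecticDual _ _
  have hωX : ∀ z w, symplecticForm d w (X z) = -fderiv ℝ H z w := fun z w => by
    rw [symplecticForm_neg_swap, hXω]
  have hX' : ∀ z v, fderiv ℝ X z v = symplecticDual d (fderiv ℝ (fderiv ℝ H) z v) := fun z v => by
    have h : HasFDerivAt X _ z := (symplecticDual d).hasFDerivAt.comp z (hHd' z).hasFDerivAt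
    rw [h.fderiv]
    rfl
  have hX'ω : ∀ z v w, symplecticForm d (fderiv ℝ X z v) w = fderiv ℝ (fderiv ℝ H) z v w :=
    fun z v w => by rw [hX', symplecticForm_symplecticDual]
  have hωX' : ∀ z v w, symplecticForm d w (fderiv ℝ X z v) = -fderiv ℝ (fderiv ℝ H) z v w :=
    fun z v w => by rw [symplecticForm_neg_swap, hX'ω]
  have hHX : ∀ z, fderiv ℝ H z (X z) = 0 := fun z => by rw [← hXω, symplecticForm_self]
  have hHX' : ∀ z v, fderiv ℝ H z (fderiv ℝ X z v) = -fderiv ℝ (fderiv ℝ H) z v (X z) :=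
    fun z v => by rw [← hXω, hωX']
  have hsymm : ∀ z v w, fderiv ℝ (fderiv ℝ H) z v w = fderiv ℝ (fderiv ℝ H) z w v :=
    fun z v w => second_derivative_symmetric (fun y => (hHd y).hasFDerivAt)
      (hHd' z).hasFDerivAt v w
  obtain ⟨Φ, hΦ, hΦ0, hev⟩ := exists_contDiffAt_flow hn hX z₀
  refine ⟨Φ, hΦ, hΦ0, hev.mono fun u => ?_⟩
  rintro ⟨γ, hγ0, hγ1, hγ', hlin⟩
  have hone : (1 : ℝ) ∈ Icc (0 : ℝ) 1 := right_mem_Icc.2 zero_le_one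
  refine ⟨?_, fun v w => ?_⟩
  · have := eq_of_hasDerivAt_zero_unitInterval (f := fun s => H (γ s)) (fun s hs => by
      have h := (hHd (γ s)).hasFDerivAt.comp_hasDerivAt s (hγ' s hs)
      rwa [map_smul, hHX, smul_zero] at h) 1 hone
    simpa only [hγ0, hγ1] using this
  · have hcons : ∀ (τ : ℝ) (ζ : ℝ → PhaseSpace d), (∀ s ∈ Icc (0 : ℝ) 1,
        HasDerivAt ζ (τ • X (γ s) + u.1 • fderiv ℝ X (γ s) (ζ s)) s) →
        ∀ s ∈ Icc (0 : ℝ) 1, fderiv ℝ H (γ s) (ζ s) = fderiv ℝ H (γ 0) (ζ 0) := by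
      intro τ ζ hζ
      refine eq_of_hasDerivAt_zero_unitInterval (f := fun s => fderiv ℝ H (γ s) (ζ s))
        fun s hs => ?_
      have h := ((hHd' (γ s)).hasFDerivAt.comp_hasDerivAt s (hγ' s hs)).clm_apply (hζ s hs)
      refine HasDerivAt.congr_deriv h ?_
      simp only [Function.comp_apply, map_add, map_smul, hHX, hHX', _root_.smul_apply,
        smul_eq_mul]
      rw [hsymm _ (X (γ s))]
      ring
    obtain ⟨ζ, hζ0, hζ1, hζ⟩ := hlin v
    obtain ⟨ξ, hξ0, hξ1, hξ⟩ := hlin w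
    have := eq_of_hasDerivAt_zero_unitInterval (f := fun s => symplecticForm d (ζ s) (ξ s) -
      s * (v.1 * fderiv ℝ H u.2 w.2 - w.1 * fderiv ℝ H u.2 v.2)) (fun s hs => by
        have h := (((symplecticForm d).hasFDerivAt.comp_hasDerivAt s (hζ s hs)).clm_apply
          (hξ s hs)).sub ((hasDerivAt_id s).mul_const
            (v.1 * fderiv ℝ H u.2 w.2 - w.1 * fderiv ℝ H u.2 v.2))
        have h1 := hcons _ _ hζ s hs
        have h2 := hcons _ _ hξ s hs
        rw [hγ0, hζ0] at h1
        rw [hγ0, hξ0] at h2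
        refine HasDerivAt.congr_deriv h ?_
        simp only [Function.comp_apply, map_add, map_smul, hXω, hωX, hX'ω, hωX',
          _root_.smul_apply, _root_.add_apply, smul_eq_mul, h1, h2]
        rw [hsymm _ (ζ s)]
        ring) 1 hone
    simp only [hζ0, hζ1, hξ0, hξ1] at this
    linarith

theorem symplecticForm_single_fst {d : ℕ} (i : Fin d) (v : PhaseSpace d) :
    symplecticForm d v (Pi.single i 1, 0) = -v.2 i := by
  simp [symplecticForm_apply, stdSymplectic, Pi.single_apply]

theorem symplecticForm_single_snd {d : ℕ} (i : Fin d) (v : PhaseSpace d) :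
    symplecticForm d v (0, Pi.single i 1) = v.1 i := by
  simp [symplecticForm_apply, stdSymplectic, Pi.single_apply]

/-- A nonzero covector is nonzero on the image of a given nonzero vector under some symplectic
transvection `v ↦ v + ω₀(v, a) a`. -/
theorem exists_transvection_ne_zero {d : ℕ} {l : PhaseSpace d →L[ℝ] ℝ} (hl : l ≠ 0)
    {e b : PhaseSpace d} (heb : symplecticForm d e b ≠ 0) :
    ∃ a, l (e + symplecticForm d e a • a) ≠ 0 := by
  by_cases hle : l e = 0
  swap
  · exact ⟨0, by simpa using hle⟩
  suffices ∃ a, symplecticForm d e a ≠ 0 ∧ l a ≠ 0 by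
    obtain ⟨a, h1, h2⟩ := this
    exact ⟨a, by simp [hle, h1, h2]⟩
  obtain ⟨c, hc⟩ : ∃ c, l c ≠ 0 := by
    by_contra! h
    exact hl (ContinuousLinearMap.ext h)
  by_cases h1 : symplecticForm d e c = 0
  swap
  · exact ⟨c, h1, hc⟩
  by_cases h2 : l b = 0
  swap
  · exact ⟨b, heb, h2⟩
  exact ⟨b + c, by simpa [h1] using heb, by simpa [h2] using hc⟩

/-- In finite dimension, an injective derivative of a self-map is an isomorphism. -/
theorem DifferentiableAt.exists_hasFDerivAt_equiv {E : Type*} [NormedAddCommGroup E]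
    [NormedSpace ℝ E] [FiniteDimensional ℝ E] {f : E → E} {x : E} (hf : DifferentiableAt ℝ f x)
    (hinj : Function.Injective (fderiv ℝ f x)) :
    ∃ f' : E ≃L[ℝ] E, HasFDerivAt f (f' : E →L[ℝ] E) x := by
  refine ⟨(LinearEquiv.ofInjectiveEndo (fderiv ℝ f x : E →ₗ[ℝ] E)
    hinj).toContinuousLinearEquiv, ?_⟩
  exact hf.hasFDerivAt.congr_fderiv (ContinuousLinearMap.ext fun _ => rfl)

/-- If `∂H/∂pᵢ ≠ 0`, then `H` is locally a momentum coordinate: the local inverse `Θ` of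
`(x, p) ↦ (x, p)` with `pᵢ` replaced by `H(x, p)`. -/
theorem exists_momentum_chart {d n : ℕ} (hn : n ≠ 0) {H : PhaseSpace d → ℝ}
    (hH : ContDiff ℝ n H) (z₀ : PhaseSpace d) (i : Fin d)
    (hi : fderiv ℝ H z₀ (0, Pi.single i 1) ≠ 0) :
    ∃ (Θ : PhaseSpace d → PhaseSpace d) (w₀ : PhaseSpace d), ContDiffAt ℝ n Θ w₀ ∧
      Θ w₀ = z₀ ∧ w₀.1 = z₀.1 ∧ ∀ᶠ w in 𝓝 w₀, H (Θ w) = w.2 i ∧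
        ∀ v, fderiv ℝ H (Θ w) (fderiv ℝ Θ w v) = v.2 i ∧
          ∃ c : ℝ, fderiv ℝ Θ w v = v + c • ((0, Pi.single i 1) : PhaseSpace d) := by
  have hn' : ((n : ℕ) : WithTop ℕ∞) ≠ 0 := by exact_mod_cast hn
  have hHd : Differentiable ℝ H := hH.differentiable hn'
  set e : PhaseSpace d := (0, Pi.single i 1) with he
  let π : PhaseSpace d →L[ℝ] ℝ := (ContinuousLinearMap.proj i).comp (.snd ℝ _ _)
  have hπ : ∀ v, π v = v.2 i := fun v => rfl
  have hπe : π e = 1 := by simp [hπ, he]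
  let θ : PhaseSpace d → PhaseSpace d := fun z => z + (H z - π z) • e
  have hθ : ContDiff ℝ n θ := by fun_prop
  have hθ' : ∀ z v, fderiv ℝ θ z v = v + (fderiv ℝ H z v - π v) • e := fun z v => by
    have h : HasFDerivAt θ _ z :=
      (hasFDerivAt_id z).add (((hHd z).hasFDerivAt.sub π.hasFDerivAt).smul_const e)
    rw [h.fderiv]
    rfl
  have hπθ : ∀ z, π (θ z) = H z := fun z => by simp [θ, hπe]
  have hinj : Function.Injective (fderiv ℝ θ z₀) := by
    refine (injective_iff_map_eq_zero _).2 fun v hv => ?_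
    rw [hθ'] at hv
    have h1 : fderiv ℝ H z₀ v = 0 := by simpa [hπe] using congrArg π hv
    rw [h1, zero_sub, neg_smul, ← sub_eq_add_neg, sub_eq_zero] at hv
    rw [hv, map_smul, smul_eq_mul, mul_eq_zero, or_iff_left hi] at h1
    rw [hv, h1, zero_smul]
  obtain ⟨θ', hθ'₀⟩ := (hθ.differentiable hn' z₀).exists_hasFDerivAt_equiv hinj
  have hθs := hθ.contDiffAt.hasStrictFDerivAt' hθ'₀ hn'
  have hΘ : ContDiffAt ℝ n (hθ.contDiffAt.localInverse hθ'₀ hn') (θ z₀) :=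
    hθ.contDiffAt.to_localInverse hθ'₀ hn'
  have hΘ0 := hθ.contDiffAt.localInverse_apply_image hθ'₀ hn'
  have hright : ∀ᶠ w in 𝓝 (θ z₀), θ (hθ.contDiffAt.localInverse hθ'₀ hn' w) = w :=
    hθs.eventually_right_inverse
  set Θ := hθ.contDiffAt.localInverse hθ'₀ hn'
  refine ⟨Θ, θ z₀, hΘ, hΘ0, by simp [θ, he], ?_⟩
  filter_upwards [hright, hright.eventually_nhds,
    hΘ.eventually (by simp)] with w hw hw' hΘw
  refine ⟨by rw [← hπθ, hw, hπ], fun v => ?_⟩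
  have h1 : HasFDerivAt (fun w => θ (Θ w)) _ w :=
    ((hθ.differentiable hn') (Θ w)).hasFDerivAt.comp w (hΘw.differentiableAt hn').hasFDerivAt
  have h2 : HasFDerivAt (fun w => θ (Θ w)) (.id ℝ _) w :=
    (hasFDerivAt_id w).congr_of_eventuallyEq hw'
  have h3 : fderiv ℝ θ (Θ w) (fderiv ℝ Θ w v) = v := congrArg (fun L => L v) (h1.unique h2)
  rw [hθ'] at h3
  refine ⟨?_, -(fderiv ℝ H (Θ w) (fderiv ℝ Θ w v) - π (fderiv ℝ Θ w v)), ?_⟩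
  · simpa [hπe, hπ v] using congrArg π h3
  · rw [neg_smul, ← sub_eq_add_neg, eq_sub_iff_add_eq, h3]

/-- Inverse of a Hamiltonian flow box, when the `i`-th momentum derivative of `H` is nonzero. -/
theorem exists_symplectic_parametrization_of_ne_zero {d n : ℕ} (hn : n ≠ 0)
    {H : PhaseSpace d → ℝ} (hH : ContDiff ℝ (n + 1) H) (z₀ : PhaseSpace d) (i : Fin d)
    (hi : fderiv ℝ H z₀ (0, Pi.single i 1) ≠ 0) :
    ∃ (Ψ : PhaseSpace d → PhaseSpace d) (w₀ : PhaseSpace d), ContDiffAt ℝ n Ψ w₀ ∧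
      Ψ w₀ = z₀ ∧ ∀ᶠ w in 𝓝 w₀, H (Ψ w) = w.2 i ∧
        ∀ v v', symplecticForm d (fderiv ℝ Ψ w v) (fderiv ℝ Ψ w v') = symplecticForm d v v' := by
  have hn' : ((n : ℕ) : WithTop ℕ∞) ≠ 0 := by exact_mod_cast hn
  obtain ⟨Φ, hΦ, hΦ0, hΦω⟩ := exists_hamiltonian_flow hn hH z₀
  obtain ⟨Θ, w₀, hΘ, hΘ0, hw₀, hΘH⟩ :=
    exists_momentum_chart hn (hH.of_le le_self_add) z₀ i hi
  set a : PhaseSpace d := (Pi.single i 1, 0) with ha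
  set e : PhaseSpace d := (0, Pi.single i 1) with he
  let ρ : PhaseSpace d →L[ℝ] ℝ := (ContinuousLinearMap.proj i).comp (.fst ℝ _ _)
  have hρ : ∀ v, ρ v = v.1 i := fun v => rfl
  have hρw₀ : ρ w₀ - ρ z₀ = 0 := by rw [hρ, hρ, hw₀, sub_self]
  let P : PhaseSpace d → PhaseSpace d := fun w => w - (ρ w - ρ z₀) • a
  have hP : ContDiff ℝ n P := by fun_prop
  have hP' : ∀ w, HasFDerivAt P (.id ℝ _ - ρ.smulRight a) w := fun w =>
    (hasFDerivAt_id w).sub ((ρ.hasFDerivAt.sub_const _).smul_const a)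
  have hP0 : P w₀ = w₀ := by simp only [P, hρw₀, zero_smul, sub_zero]
  let G : PhaseSpace d → ℝ × PhaseSpace d := fun w => (ρ w - ρ z₀, Θ (P w))
  have hG0 : G w₀ = (0, z₀) := by simp only [G, hρw₀, hP0, hΘ0]
  have hG : ContDiffAt ℝ n G w₀ := by
    refine ContDiffAt.prodMk (by fun_prop) ?_
    exact ContDiffAt.comp w₀ (by rwa [hP0]) hP.contDiffAt
  have hPt : Filter.Tendsto P (𝓝 w₀) (𝓝 w₀) := by
    simpa only [hP0] using hP.continuous.tendsto w₀
  have hGt : Filter.Tendsto G (𝓝 w₀) (𝓝 (0, z₀)) := by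
    simpa only [hG0] using hG.continuousAt.tendsto
  refine ⟨fun w => Φ (G w), w₀, ContDiffAt.comp w₀ (by rwa [hG0]) hG, by simp only [hG0, hΦ0], ?_⟩
  filter_upwards [hPt.eventually hΘH, hPt.eventually (hΘ.eventually (by simp)),
    hGt.eventually hΦω, hGt.eventually (hΦ.eventually (by simp))] with w h1 h2 h3 h4
  refine ⟨?_, fun v v' => ?_⟩
  · rw [h3.1, h1.1]
    simp [P, ha]
  · have hD : ∀ v, fderiv ℝ (fun w => Φ (G w)) w v =
        fderiv ℝ Φ (G w) (ρ v, fderiv ℝ Θ (P w) (v - ρ v • a)) := by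
      intro v
      have hGw : HasFDerivAt G _ w := (ρ.hasFDerivAt.sub_const _).prodMk
        ((h2.differentiableAt hn').hasFDerivAt.comp w (hP' w))
      have h : HasFDerivAt (fun w => Φ (G w)) _ w :=
        (h4.differentiableAt hn').hasFDerivAt.comp w hGw
      rw [h.fderiv]
      rfl
    rw [hD, hD, h3.2]
    obtain ⟨hv, c, hc⟩ := h1.2 (v - ρ v • a)
    obtain ⟨hv', c', hc'⟩ := h1.2 (v' - ρ v' • a)
    change _ + (ρ v * fderiv ℝ H (Θ (P w)) _ - ρ v' * fderiv ℝ H (Θ (P w)) _) = _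
    rw [hv, hv', hc, hc']
    have ha1 : ∀ v, symplecticForm d v a = -v.2 i := symplecticForm_single_fst i
    have he1 : ∀ v, symplecticForm d v e = v.1 i := symplecticForm_single_snd i
    have ha2 : ∀ v, symplecticForm d a v = v.2 i := fun v => by
      rw [symplecticForm_neg_swap, ha1, neg_neg]
    have he2 : ∀ v, symplecticForm d e v = -v.1 i := fun v => by
      rw [symplecticForm_neg_swap, he1]
    simp only [map_add, map_sub, map_smul, _root_.add_apply, _root_.sub_apply,
      _root_.smul_apply, smul_eq_mul, ha1, he1, ha2, he2, hρ]
    simp [ha, he]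
    ring

/-- Inverse of a Hamiltonian flow box near a regular point of `H`. -/
theorem exists_symplectic_parametrization {d n : ℕ} (hn : n ≠ 0) {H : PhaseSpace d → ℝ}
    (hH : ContDiff ℝ (n + 1) H) (z₀ : PhaseSpace d) (hz₀ : fderiv ℝ H z₀ ≠ 0) (i : Fin d) :
    ∃ (Ψ : PhaseSpace d → PhaseSpace d) (w₀ : PhaseSpace d), ContDiffAt ℝ n Ψ w₀ ∧
      Ψ w₀ = z₀ ∧ ∀ᶠ w in 𝓝 w₀, H (Ψ w) = w.2 i ∧
        ∀ v v', symplecticForm d (fderiv ℝ Ψ w v) (fderiv ℝ Ψ w v') = symplecticForm d v v' := by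
  have hn' : ((n : ℕ) : WithTop ℕ∞) ≠ 0 := by exact_mod_cast hn
  obtain ⟨a, ha⟩ := exists_transvection_ne_zero hz₀ (e := (0, Pi.single i 1))
    (b := (Pi.single i 1, 0)) (by simp [symplecticForm_single_fst])
  let S : PhaseSpace d →L[ℝ] PhaseSpace d := .id ℝ _ + ((symplecticForm d).flip a).smulRight a
  have hS : ∀ v, S v = v + symplecticForm d v a • a := fun v => rfl
  have hSω : ∀ v w, symplecticForm d (S v) (S w) = symplecticForm d v w := fun v w => by
    simp only [hS, map_add, map_smul, _root_.add_apply, _root_.smul_apply, smul_eq_mul,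
      symplecticForm_self, symplecticForm_neg_swap a w]
    ring
  obtain ⟨z₁, hz₁⟩ : ∃ z₁, S z₁ = z₀ :=
    ⟨z₀ - symplecticForm d z₀ a • a, by simp [hS, symplecticForm_self]⟩
  have hHS : ContDiff ℝ (n + 1) (fun z => H (S z)) := hH.comp S.contDiff
  obtain ⟨Ψ, w₀, hΨ, hΨ0, hev⟩ := exists_symplectic_parametrization_of_ne_zero hn hHS z₁ i (by
    have h : HasFDerivAt (fun z => H (S z)) _ z₁ :=
      ((hH.differentiable (by simp)) (S z₁)).hasFDerivAt.comp z₁ S.hasFDerivAt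
    rw [h.fderiv, hz₁]
    exact ha)
  refine ⟨fun w => S (Ψ w), w₀, S.contDiff.contDiffAt.comp _ hΨ, by simp only [hΨ0, hz₁], ?_⟩
  filter_upwards [hev, hΨ.eventually (by simp)] with w hw hΨw
  refine ⟨hw.1, fun v v' => ?_⟩
  have h : HasFDerivAt (fun w => S (Ψ w)) _ w :=
    S.hasFDerivAt.comp w (hΨw.differentiableAt hn').hasFDerivAt
  rw [h.fderiv]
  exact (hSω _ _).trans (hw.2 v v')

theorem injective_of_symplecticForm_map {d : ℕ} {A : PhaseSpace d →L[ℝ] PhaseSpace d}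
    (hA : ∀ v w, symplecticForm d (A v) (A w) = symplecticForm d v w) : Function.Injective A := by
  refine (injective_iff_map_eq_zero _).2 fun v hv => ?_
  have h0 : ∀ w, symplecticForm d v w = 0 := fun w => by rw [← hA, hv, map_zero]; rfl
  ext i
  · simpa [symplecticForm_single_snd] using h0 (0, Pi.single i 1)
  · simpa [symplecticForm_single_fst] using h0 (Pi.single i 1, 0)

end Hamiltonian

/-- Hamiltonian flow-box theorem on `(ℝ^{2d}, ω₀)`: near a point where `DH ≠ 0`, there is a
local `C^{k−1}` diffeomorphism `ψ` whose differential preserves `ω₀` at every point of its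
domain and which transforms `H` into the first momentum coordinate `p₁`. -/
theorem hamiltonian_flow_box (d k : ℕ) (hd : 1 ≤ d) (hk : 2 ≤ k)
    (H : (Fin d → ℝ) × (Fin d → ℝ) → ℝ) (hH : ContDiff ℝ k H)
    (z₀ : (Fin d → ℝ) × (Fin d → ℝ)) (hz₀ : fderiv ℝ H z₀ ≠ 0) :
    ∃ U V : Set ((Fin d → ℝ) × (Fin d → ℝ)), IsOpen U ∧ IsOpen V ∧ z₀ ∈ U ∧
      ∃ ψ ψinv : (Fin d → ℝ) × (Fin d → ℝ) → (Fin d → ℝ) × (Fin d → ℝ),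
        BijOn ψ U V ∧ InvOn ψinv ψ U V ∧
        ContDiffOn ℝ (k - 1) ψ U ∧ ContDiffOn ℝ (k - 1) ψinv V ∧
        (∀ u ∈ U, ∀ v w : (Fin d → ℝ) × (Fin d → ℝ),
          stdSymplectic d (fderiv ℝ ψ u v) (fderiv ℝ ψ u w) = stdSymplectic d v w) ∧
        (∀ u ∈ U, H u = (ψ u).2 ⟨0, hd⟩) := by
  obtain ⟨n, rfl⟩ : ∃ n, k = n + 1 := ⟨k - 1, by omega⟩
  have hn : n ≠ 0 := by omega
  have hn' : ((n : ℕ) : WithTop ℕ∞) ≠ 0 := by exact_mod_cast hn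
  have hsub : (((n + 1 : ℕ) : WithTop ℕ∞) - 1) = n := by
    change (((n + 1 : ℕ) : ℕ∞) : WithTop ℕ∞) - ((1 : ℕ∞) : WithTop ℕ∞) = ((n : ℕ∞) : WithTop ℕ∞)
    rw [← WithTop.coe_sub]
    exact congrArg _ (by norm_cast)
  rw [hsub]
  obtain ⟨Ψ, w₀, hΨ, hΨ0, hev⟩ :=
    exists_symplectic_parametrization hn (by exact_mod_cast hH) z₀ hz₀ ⟨0, hd⟩
  obtain ⟨W, hW, hWo, hw₀⟩ := eventually_nhds_iff.1 (hev.and (hΨ.eventually (by simp)))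
  have hequiv : ∀ w ∈ W, ∃ A : PhaseSpace d ≃L[ℝ] PhaseSpace d,
      HasFDerivAt Ψ (A : PhaseSpace d →L[ℝ] PhaseSpace d) w := fun w hw =>
    ((hW w hw).2.differentiableAt hn').exists_hasFDerivAt_equiv
      (injective_of_symplecticForm_map (hW w hw).1.2)
  obtain ⟨A₀, hA₀⟩ := hequiv w₀ hw₀
  let e := (hΨ.toOpenPartialHomeomorph Ψ hA₀ hn').restrOpen W hWo
  have he : ∀ w, e w = Ψ w := fun w => rfl
  have heW : ∀ w ∈ e.source, w ∈ W := fun w hw => hw.2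
  have hmem : w₀ ∈ e.source := ⟨hΨ.mem_toOpenPartialHomeomorph_source hA₀ hn', hw₀⟩
  refine ⟨e.target, e.source, e.open_target, e.open_source, ?_, e.symm, e, e.symm.bijOn,
    e.symm.invOn, fun u hu => ?_, fun w hw => ?_, fun u hu v w => ?_, fun u hu => ?_⟩
  · simpa only [he, hΨ0] using e.map_source hmem
  · have hw := heW _ (e.map_target hu)
    obtain ⟨A, hA⟩ := hequiv _ hw
    exact (e.contDiffAt_symm hu hA (hW _ hw).2).contDiffWithinAt
  · exact (hW w (heW w hw)).2.contDiffWithinAt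
  · have hw := heW _ (e.map_target hu)
    obtain ⟨A, hA⟩ := hequiv _ hw
    have hsymm : HasFDerivAt e.symm (A.symm : PhaseSpace d →L[ℝ] PhaseSpace d) u :=
      e.hasFDerivAt_symm hu hA
    have h := (hW _ hw).1.2 (A.symm v) (A.symm w)
    rw [hA.fderiv] at h
    rw [hsymm.fderiv]
    simpa [symplecticForm_apply] using h.symm
  · have h := (hW _ (heW _ (e.map_target hu))).1.1
    rwa [← he, e.right_inv hu] at h
end

section
/- Let k ≥ 2 be an integer, let H₁ : E → ℝ be H₁(x, p) = p₁, let H₂ : E → ℝ be of class C^k, and let z ∈ E. Define vector fields Y₀ = X_{H₂} and Y_m = [X_{H₁}, Y_{m−1}] for 1 ≤ m ≤ k − 2. Then the values X_{H₁}(z), Y₀(z), Y₁(z), …, Y_{k−2}(z) span E if and only if the differentials DH₁(z) (= dp₁), DH₂(z), D(∂H₂/∂x₁)(z), …, D(∂^{k−2}H₂/∂x₁^{k−2})(z) span the dual space E*; equivalently, if and only if the k × 2d matrix whose rows are the row of dp₁ and the rows of partial derivatives (∂_{x₁}∂_{x₁^m}H₂, …, ∂_{x_d}∂_{x₁^m}H₂,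 ∂_{p₁}∂_{x₁^m}H₂, …, ∂_{p_d}∂_{x₁^m}H₂)(z) for m = 0, …, k−2 has rank 2d. (The explicit rank formulation of the condition Lie^{k−2}₁(X_{H₁}, X_{H₂})(z) = T_zN derived in the proof of Lemma 3.3 of the paper.) -/
open Set

/-- Partial derivative of `F : ℝᵈ × ℝᵈ → ℝ` in the `i`-th position coordinate `xᵢ`. -/
noncomputable def pdx {d : ℕ} (i : Fin d) (F : (Fin d → ℝ) × (Fin d → ℝ) → ℝ)
    (z : (Fin d → ℝ) × (Fin d → ℝ)) : ℝ :=
  fderiv ℝ F z (Pi.single i 1, 0)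

/-- Partial derivative of `F : ℝᵈ × ℝᵈ → ℝ` in the `i`-th momentum coordinate `pᵢ`. -/
noncomputable def pdp {d : ℕ} (i : Fin d) (F : (Fin d → ℝ) × (Fin d → ℝ) → ℝ)
    (z : (Fin d → ℝ) × (Fin d → ℝ)) : ℝ :=
  fderiv ℝ F z (0, Pi.single i 1)

/-- The Hamiltonian vector field `X_F(z) = (∂F/∂p₁, …, ∂F/∂p_d, −∂F/∂x₁, …, −∂F/∂x_d)(z)`. -/
noncomputable def hamVF {d : ℕ} (F : (Fin d → ℝ) × (Fin d → ℝ) → ℝ)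
    (z : (Fin d → ℝ) × (Fin d → ℝ)) : (Fin d → ℝ) × (Fin d → ℝ) :=
  (fun i => pdp i F z, fun i => - pdx i F z)

/-- The iterated Lie brackets `Y₀ = X_{H₂}`, `Y_m = [X_{H₁}, Y_{m−1}]`. -/
noncomputable def iterAd {d : ℕ} (H₁ H₂ : (Fin d → ℝ) × (Fin d → ℝ) → ℝ) :
    ℕ → (Fin d → ℝ) × (Fin d → ℝ) → (Fin d → ℝ) × (Fin d → ℝ)
  | 0 => hamVF H₂
  | m + 1 => VectorField.lieBracket ℝ (hamVF H₁) (iterAd H₁ H₂ m)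

/-- The coordinates of a covector on `ℝᵈ × ℝᵈ` with respect to `dx₁, …, dx_d, dp₁, …, dp_d`. -/
noncomputable def covectorCoords (d : ℕ) :
    ((Fin d → ℝ) × (Fin d → ℝ) →L[ℝ] ℝ) ≃ₗ[ℝ] (Fin d ⊕ Fin d → ℝ) :=
  LinearMap.toContinuousLinearMap.symm ≪≫ₗ
    (((Pi.basisFun ℝ (Fin d)).prod (Pi.basisFun ℝ (Fin d))).constr ℝ).symm

lemma covectorCoords_inl {d : ℕ} (L : (Fin d → ℝ) × (Fin d → ℝ) →L[ℝ] ℝ) (i : Fin d) :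
    covectorCoords d L (Sum.inl i) = L (Pi.single i 1, 0) := by
  simp [covectorCoords, Module.Basis.constr]

lemma covectorCoords_inr {d : ℕ} (L : (Fin d → ℝ) × (Fin d → ℝ) →L[ℝ] ℝ) (i : Fin d) :
    covectorCoords d L (Sum.inr i) = L (0, Pi.single i 1) := by
  simp [covectorCoords, Module.Basis.constr]

/-- The symplectic isomorphism from covectors to vectors, which sends `dF(z)` to `X_F(z)`. -/
noncomputable def symplecticSharp (d : ℕ) :
    ((Fin d → ℝ) × (Fin d → ℝ) →L[ℝ] ℝ) ≃ₗ[ℝ] (Fin d → ℝ) × (Fin d → ℝ) :=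
  covectorCoords d ≪≫ₗ LinearEquiv.sumArrowLequivProdArrow (Fin d) (Fin d) ℝ ℝ ≪≫ₗ
    LinearEquiv.prodComm ℝ _ _ ≪≫ₗ (LinearEquiv.refl ℝ _).prodCongr (LinearEquiv.neg ℝ)

lemma symplecticSharp_apply {d : ℕ} (L : (Fin d → ℝ) × (Fin d → ℝ) →L[ℝ] ℝ) :
    symplecticSharp d L = (fun i => L (0, Pi.single i 1), fun i => -L (Pi.single i 1, 0)) := by
  ext i <;> simp [symplecticSharp, covectorCoords_inl, covectorCoords_inr]

lemma hamVF_eq_symplecticSharp {d : ℕ} (F : (Fin d → ℝ) × (Fin d → ℝ) → ℝ) :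
    hamVF F = fun z => symplecticSharp d (fderiv ℝ F z) := by
  ext1 z
  rw [symplecticSharp_apply]
  rfl

lemma fderiv_snd_coord {d : ℕ} (i : Fin d) (z : (Fin d → ℝ) × (Fin d → ℝ)) :
    fderiv ℝ (fun w : (Fin d → ℝ) × (Fin d → ℝ) => w.2 i) z =
      (ContinuousLinearMap.proj i).comp (ContinuousLinearMap.snd ℝ (Fin d → ℝ) (Fin d → ℝ)) :=
  ((ContinuousLinearMap.proj (R := ℝ) (φ := fun _ : Fin d => ℝ) i).comp
    (ContinuousLinearMap.snd ℝ (Fin d → ℝ) (Fin d → ℝ))).hasFDerivAt.fderiv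

lemma hamVF_snd_coord {d : ℕ} (i : Fin d) :
    hamVF (fun w : (Fin d → ℝ) × (Fin d → ℝ) => w.2 i) = fun _ => (Pi.single i 1, 0) := by
  ext z j
  · simp [hamVF, pdp, fderiv_snd_coord, Pi.single_apply, eq_comm]
  · simp [hamVF, pdx, fderiv_snd_coord]

lemma ContDiff.pdx {d : ℕ} {n m : WithTop ℕ∞} {F : (Fin d → ℝ) × (Fin d → ℝ) → ℝ}
    (hF : ContDiff ℝ n F) (hmn : m + 1 ≤ n) (i : Fin d) : ContDiff ℝ m (pdx i F) :=
  (hF.fderiv_right hmn).clm_apply contDiff_const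

lemma fderiv_pdx {d : ℕ} {F : (Fin d → ℝ) × (Fin d → ℝ) → ℝ} (hF : ContDiff ℝ 2 F)
    (i : Fin d) (z : (Fin d → ℝ) × (Fin d → ℝ)) :
    fderiv ℝ (pdx i F) z = fderiv ℝ (fderiv ℝ F) z (Pi.single i 1, 0) := by
  have hd : DifferentiableAt ℝ (fderiv ℝ F) z :=
    ((hF.fderiv_right (m := 1) (by norm_num)).differentiable (by norm_num)).differentiableAt
  have hsymm : IsSymmSndFDerivAt ℝ F z := hF.contDiffAt.isSymmSndFDerivAt (by simp)
  refine ContinuousLinearMap.ext fun u => ?_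
  have h := (hd.hasFDerivAt.clm_apply (hasFDerivAt_const (Pi.single i 1, 0) z)).fderiv
  change fderiv ℝ (fun w => fderiv ℝ F w (Pi.single i 1, 0)) z u = _
  rw [h]
  simpa using hsymm u (Pi.single i 1, 0)

/-- The bracket of `X_{pᵢ} = ∂/∂xᵢ` with `X_F` is `X_{∂F/∂xᵢ}`. -/
lemma lieBracket_hamVF_snd_coord {d : ℕ} {F : (Fin d → ℝ) × (Fin d → ℝ) → ℝ}
    (hF : ContDiff ℝ 2 F) (i : Fin d) :
    VectorField.lieBracket ℝ (hamVF fun w => w.2 i) (hamVF F) = hamVF (pdx i F) := by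
  ext1 z
  have hd : DifferentiableAt ℝ (fderiv ℝ F) z :=
    ((hF.fderiv_right (m := 1) (by norm_num)).differentiable (by norm_num)).differentiableAt
  have h := ((symplecticSharp d).toContinuousLinearEquiv.toContinuousLinearMap.hasFDerivAt.comp z
    hd.hasFDerivAt).fderiv
  have hfd : fderiv ℝ (hamVF F) z (Pi.single i 1, 0) =
      symplecticSharp d (fderiv ℝ (fderiv ℝ F) z (Pi.single i 1, 0)) := by
    rw [hamVF_eq_symplecticSharp]
    exact congrArg (fun L => L (Pi.single i 1, 0)) h
  rw [VectorField.lieBracket_eq, hamVF_snd_coord]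
  simp [hfd, hamVF_eq_symplecticSharp (pdx i F), fderiv_pdx hF]

lemma ContDiff.iterate_pdx {d : ℕ} (i : Fin d) {F : (Fin d → ℝ) × (Fin d → ℝ) → ℝ} (m : ℕ) :
    ∀ {n : ℕ}, ContDiff ℝ (n + m : ℕ) F → ContDiff ℝ n ((_root_.pdx i)^[m] F) := by
  induction m with
  | zero => exact fun h => h
  | succ m ih =>
    intro n hF
    rw [Function.iterate_succ_apply']
    exact (ih (n := n + 1) (by rwa [add_right_comm])).pdx (by norm_cast) i

lemma iterAd_snd_coord {d : ℕ} (i : Fin d) {F : (Fin d → ℝ) × (Fin d → ℝ) → ℝ} {m : ℕ}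
    (hF : ContDiff ℝ (m + 1 : ℕ) F) :
    iterAd (fun w => w.2 i) F m = hamVF ((pdx i)^[m] F) := by
  induction m with
  | zero => rfl
  | succ m ih =>
    rw [iterAd, ih (hF.of_le (by norm_cast; lia)), Function.iterate_succ_apply']
    exact lieBracket_hamVF_snd_coord
      (ContDiff.iterate_pdx i m (n := 2) (by rwa [show 2 + m = m + 1 + 1 by ring])) i

lemma span_image_linearEquiv_eq_top_iff {R M N : Type*} [Semiring R] [AddCommMonoid M]
    [AddCommMonoid N] [Module R M] [Module R N] (e : M ≃ₗ[R] N) (s : Set M) :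
    Submodule.span R (e '' s) = ⊤ ↔ Submodule.span R s = ⊤ := by
  rw [← LinearEquiv.coe_coe, Submodule.span_image]
  exact Submodule.map_eq_top_iff

lemma rank_eq_card_iff_span_row_eq_top {m n K : Type*} [Finite m] [Fintype n] [Field K]
    (A : Matrix m n K) :
    A.rank = Fintype.card n ↔ Submodule.span K (Set.range A.row) = ⊤ := by
  rw [A.rank_eq_finrank_span_row, ← Module.finrank_fintype_fun_eq_card K]
  exact ⟨Submodule.eq_top_of_finrank_eq, fun h => by rw [h, finrank_top]⟩

/-- For `H₁(x,p) = p₁` and `H₂` of class `C^k`, the values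
`X_{H₁}(z), Y₀(z), …, Y_{k−2}(z)` span `ℝᵈ × ℝᵈ` iff the differentials
`dp₁, DH₂(z), D(∂H₂/∂x₁)(z), …, D(∂^{k−2}H₂/∂x₁^{k−2})(z)` span the dual space, iff the
`k × 2d` matrix whose rows are the row of `dp₁` and the rows of all partial derivatives of
`∂^m H₂/∂x₁^m` for `m = 0, …, k−2` has rank `2d`. -/
theorem lie_span_iff_dual_span_iff_rank
    (d k : ℕ) (hd : 1 ≤ d) (hk : 2 ≤ k)
    (H₂ : (Fin d → ℝ) × (Fin d → ℝ) → ℝ) (hH₂ : ContDiff ℝ k H₂)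
    (z : (Fin d → ℝ) × (Fin d → ℝ)) :
    (Submodule.span ℝ
        (insert (hamVF (fun w => w.2 ⟨0, hd⟩) z)
          {v | ∃ m ≤ k - 2, v = iterAd (fun w => w.2 ⟨0, hd⟩) H₂ m z}) = ⊤ ↔
      Submodule.span ℝ
        (insert (fderiv ℝ (fun w : (Fin d → ℝ) × (Fin d → ℝ) => w.2 ⟨0, hd⟩) z)
          {L : (Fin d → ℝ) × (Fin d → ℝ) →L[ℝ] ℝ |
            ∃ m ≤ k - 2, L = fderiv ℝ ((pdx ⟨0, hd⟩)^[m] H₂) z}) = ⊤) ∧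
    (Submodule.span ℝ
        (insert (fderiv ℝ (fun w : (Fin d → ℝ) × (Fin d → ℝ) => w.2 ⟨0, hd⟩) z)
          {L : (Fin d → ℝ) × (Fin d → ℝ) →L[ℝ] ℝ |
            ∃ m ≤ k - 2, L = fderiv ℝ ((pdx ⟨0, hd⟩)^[m] H₂) z}) = ⊤ ↔
      (Matrix.of fun (r : Option (Fin (k - 1))) (c : Fin d ⊕ Fin d) =>
          match r, c with
          | none, Sum.inl _ => (0 : ℝ)
          | none, Sum.inr j => if j = (⟨0, hd⟩ : Fin d) then 1 else 0
          | some m, Sum.inl j => pdx j ((pdx ⟨0, hd⟩)^[(m : ℕ)] H₂) z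
          | some m, Sum.inr j => pdp j ((pdx ⟨0, hd⟩)^[(m : ℕ)] H₂) z).rank = 2 * d) := by
  set i : Fin d := ⟨0, hd⟩
  constructor
  · rw [← span_image_linearEquiv_eq_top_iff (symplecticSharp d), Set.image_insert_eq,
      hamVF_eq_symplecticSharp]
    have hset : {v | ∃ m ≤ k - 2, v = iterAd (fun w => w.2 i) H₂ m z} =
        symplecticSharp d '' {L | ∃ m ≤ k - 2, L = fderiv ℝ ((pdx i)^[m] H₂) z} := by
      have hm : ∀ m ≤ k - 2, iterAd (fun w => w.2 i) H₂ m z =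
          symplecticSharp d (fderiv ℝ ((pdx i)^[m] H₂) z) := fun m hm => by
        rw [iterAd_snd_coord i (hH₂.of_le (by norm_cast; lia)), hamVF_eq_symplecticSharp]
      ext v
      constructor
      · rintro ⟨m, hmk, rfl⟩
        exact ⟨_, ⟨m, hmk, rfl⟩, (hm m hmk).symm⟩
      · rintro ⟨_, ⟨m, hmk, rfl⟩, rfl⟩
        exact ⟨m, hmk, (hm m hmk).symm⟩
    rw [hset]
  · rw [← span_image_linearEquiv_eq_top_iff (covectorCoords d),
      show 2 * d = Fintype.card (Fin d ⊕ Fin d) by simp [two_mul],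
      rank_eq_card_iff_span_row_eq_top]
    have hcoords : ∀ m, covectorCoords d (fderiv ℝ ((pdx i)^[m] H₂) z) =
        Sum.elim (fun j => pdx j ((pdx i)^[m] H₂) z) (fun j => pdp j ((pdx i)^[m] H₂) z) := by
      intro m
      ext (j | j)
      · exact covectorCoords_inl _ j
      · exact covectorCoords_inr _ j
    have hcoords₁ : covectorCoords d
        (fderiv ℝ (fun w : (Fin d → ℝ) × (Fin d → ℝ) => w.2 i) z) =
        Sum.elim (fun _ => 0) (fun j => if j = i then 1 else 0) := by
      ext (j | j)
      · simp [covectorCoords_inl, fderiv_snd_coord]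
      · simp [covectorCoords_inr, fderiv_snd_coord, Pi.single_apply, eq_comm]
    refine Eq.congr_left (congrArg (Submodule.span ℝ) ?_)
    rw [Set.image_insert_eq, hcoords₁]
    ext v
    constructor
    · rintro (rfl | ⟨_, ⟨m, hmk, rfl⟩, rfl⟩)
      · exact ⟨none, by ext (j | j) <;> rfl⟩
      · rw [hcoords]
        exact ⟨some ⟨m, by lia⟩, by ext (j | j) <;> rfl⟩
    · rintro ⟨_ | m, rfl⟩
      · exact Or.inl (by ext (j | j) <;> rfl)
      · refine Or.inr ⟨_, ⟨m, by lia, rfl⟩, ?_⟩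
        rw [hcoords]
        ext (j | j) <;> rfl
end

section
/- Let E be a real normed vector space, let γ : ℝ → E be a differentiable map, and let (S_l)_{l ∈ ℕ} be a countable family of subsets of E. Assume that for every l ∈ ℕ and every t ∈ ℝ with γ(t) ∈ S_l, neither γ'(t) nor −γ'(t) belongs to the tangent cone of S_l at γ(t). Then the set {t ∈ ℝ : γ(t) ∈ ⋃_l S_l} has empty interior in ℝ. In particular, for every t₀ ∈ ℝ, the point γ(t₀) belongs to the closure of {γ(t) : t > t₀ and γ(t) ∉ ⋃_l S_l} and to the closure of {γ(t) : t < t₀ and γ(t) ∉ ⋃_l S_l}. (Proposition 3.4 of the paper in tangent-cone form: there γ is a flow line of the Hamiltonian vector field X_{H₂} and the sets S_l are the C² submanifolds N^l covering the critical set N₀ of H₁, the hypothesis being X_{H₂}(z) ∉ T_z N^l for z ∈ N^l.) -/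
open Set Filter Topology

/-- A set of real numbers none of whose points is an accumulation point of it is countable. -/
theorem Set.countable_of_forall_not_accPt {A : Set ℝ} (hA : ∀ t ∈ A, ¬ AccPt t (𝓟 A)) :
    A.Countable := by
  have hsub : A ⊆ {t ∈ A | 𝓝[A ∩ Ioi t] t = ⊥} := by
    intro t ht
    have hacc := hA t ht
    rw [AccPt, neBot_iff, not_not, ← nhdsWithin_inter', inter_comm] at hacc
    exact ⟨ht, le_bot_iff.1 (hacc ▸ nhdsWithin_mono t
      (inter_subset_inter_right A fun _ hx => ne_of_gt hx))⟩
  exact countable_setOfPred_isolated_right_within.mono hsub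

/-- A curve that is differentiable at an accumulation point of the times it spends in `S` has
velocity in the tangent cone of `S`. -/
theorem HasDerivAt.mem_tangentConeAt_of_accPt {E : Type*} [NormedAddCommGroup E]
    [NormedSpace ℝ E] {γ : ℝ → E} {v : E} {t : ℝ} {S : Set E} (hγ : HasDerivAt γ v t)
    (ht : AccPt t (𝓟 (γ ⁻¹' S))) : v ∈ tangentConeAt ℝ S (γ t) := by
  have h1 : (1 : ℝ) ∈ tangentConeAt ℝ (γ ⁻¹' S) t := by
    rw [tangentConeAt_eq_univ ht]
    trivial
  have h2 := (hγ.hasFDerivAt.hasFDerivWithinAt (s := γ ⁻¹' S)).mapsTo_tangent_cone h1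
  simpa using tangentConeAt_mono (image_preimage_subset γ S) h2

/-- Proposition 3.4 in tangent-cone form: if a differentiable curve `γ` meets each set `S l`
only with velocity transverse to its tangent cone (in both time directions), then the set of
times at which `γ` lies in `⋃ l, S l` has empty interior; in particular every point `γ t₀`
is accumulated, from the future and from the past, by points of the curve outside `⋃ l, S l`. -/
theorem curve_avoids_countable_union_of_transversal
    {E : Type*} [NormedAddCommGroup E] [NormedSpace ℝ E]
    (γ : ℝ → E) (hγ : Differentiable ℝ γ) (S : ℕ → Set E)
    (h : ∀ l : ℕ, ∀ t : ℝ, γ t ∈ S l →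
      deriv γ t ∉ tangentConeAt ℝ (S l) (γ t) ∧
      -deriv γ t ∉ tangentConeAt ℝ (S l) (γ t)) :
    interior {t : ℝ | γ t ∈ ⋃ l, S l} = ∅ ∧
    ∀ t₀ : ℝ,
      γ t₀ ∈ closure (γ '' {t : ℝ | t₀ < t ∧ γ t ∉ ⋃ l, S l}) ∧
      γ t₀ ∈ closure (γ '' {t : ℝ | t < t₀ ∧ γ t ∉ ⋃ l, S l}) := by
  have hdense : Dense {t : ℝ | γ t ∈ ⋃ l, S l}ᶜ := by
    have hcount : {t : ℝ | γ t ∈ ⋃ l, S l}.Countable := by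
      have heq : {t : ℝ | γ t ∈ ⋃ l, S l} = ⋃ l, γ ⁻¹' S l := by
        ext t
        simp
      rw [heq]
      exact countable_iUnion fun l => countable_of_forall_not_accPt fun t ht hacc =>
        (h l t ht).1 ((hγ t).hasDerivAt.mem_tangentConeAt_of_accPt hacc)
    exact hcount.dense_compl ℝ
  have hclosure : ∀ (t₀ : ℝ) (U : Set ℝ), IsOpen U → t₀ ∈ closure U →
      γ t₀ ∈ closure (γ '' (U ∩ {t : ℝ | γ t ∈ ⋃ l, S l}ᶜ)) := by
    intro t₀ U hU ht₀
    refine image_closure_subset_closure_image hγ.continuous (mem_image_of_mem γ ?_)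
    exact closure_minimal (hdense.open_subset_closure_inter hU) isClosed_closure ht₀
  refine ⟨interior_eq_empty_iff_dense_compl.2 hdense, fun t₀ => ⟨?_, ?_⟩⟩
  · exact hclosure t₀ (Ioi t₀) isOpen_Ioi (by simp)
  · exact hclosure t₀ (Iio t₀) isOpen_Iio (by simp)
end
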